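/- arXiv:1406.5462 — 2 statements merged into one kernel-verified Lean document; each statement's English description precedes it below -/
import Mathlib

section
/- Let R be an admissible function with R(x) ≥ 0 for all real x and R(0) ≥ 1. Then M(R) ≥ 2^{−1/2}·cot(2^{−1/2}) − 1/2. Equality holds if and only if R is the restriction to ℝ of the entire function z ↦ (1 − 2π²z²)^{−2}·(cos(πz) − 2^{1/2}πz·cot(2^{−1/2})·sin(πz))². -/
open Filter MeasureTheory Real Complex

/-- The constant `2^{-1/2}`. -/
noncomputable def invSqrt2 : ℝ := (Real.sqrt 2)⁻¹

/-- The pair correlation density `1 - (sin πx / (πx))²`. -/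
noncomputable def pairCorKernel (x : ℝ) : ℝ := 1 - (Real.sin (π * x) / (π * x)) ^ 2

/-- An entire function has exponential type at most `τ`. -/
def HasExpTypeLE (F : ℂ → ℂ) (τ : ℝ) : Prop :=
  ∀ ε > 0, ∃ C > 0, ∀ z : ℂ, ‖F z‖ ≤ C * Real.exp ((τ + ε) * ‖z‖)

/-- A function `R : ℝ → ℝ` is admissible if it is integrable and extends to an entire
function of exponential type at most `2π`. -/
def IsAdmissible (R : ℝ → ℝ) : Prop :=
  Integrable R ∧
    ∃ F : ℂ → ℂ, Differentiable ℂ F ∧ HasExpTypeLE F (2 * π) ∧ ∀ x : ℝ, F x = (R x : ℂ)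

/-- `M(R) = ∫ R(x) {1 - (sin πx/(πx))²} dx`. -/
noncomputable def Mpc (R : ℝ → ℝ) : ℝ := ∫ x : ℝ, R x * pairCorKernel x

open scoped Topology


/-- removable-singularity extension -/
noncomputable def remExt (u : ℂ → ℂ) (z : ℂ) : ℂ := limUnder (𝓝[≠] z) u

lemma remExt_eq {u : ℂ → ℂ} {z : ℂ} (h : ContinuousAt u z) : remExt u z = u z :=
  (h.tendsto.mono_left nhdsWithin_le_nhds).limUnder_eq

lemma remExt_diff {u : ℂ → ℂ} {c : ℂ} (hd : ∀ᶠ z in 𝓝[≠] c, DifferentiableAt ℂ u z)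
    (h0 : Tendsto (fun z => (z - c) * u z) (𝓝[≠] c) (𝓝 0)) :
    DifferentiableAt ℂ (remExt u) c := by
  have hd' := hd
  rw [eventually_nhdsWithin_iff] at hd
  obtain ⟨s, hs, hsub⟩ := Filter.eventually_iff_exists_mem.1 hd
  have ho : (fun z => u z - u c) =o[𝓝[≠] c] fun z => (z - c)⁻¹ := by
    rw [Asymptotics.isLittleO_iff_tendsto']
    · have h1 : Tendsto (fun z => (z - c) * u c) (𝓝[≠] c) (𝓝 0) := by
        have : Continuous fun z => (z - c) * u c := by fun_prop
        have h2 := this.tendsto c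
        simp only [sub_self, zero_mul] at h2
        exact h2.mono_left nhdsWithin_le_nhds
      have h3 := h0.sub h1
      simp only [sub_zero] at h3
      refine h3.congr fun z => ?_
      rw [div_inv_eq_mul]; ring
    · filter_upwards [self_mem_nhdsWithin] with z hz h
      exact absurd (inv_eq_zero.1 h) (sub_ne_zero.2 hz)
  have key := Complex.differentiableOn_update_limUnder_of_isLittleO (s := s) (c := c) hs
    (fun z hz => (hsub z hz.1 hz.2).differentiableWithinAt) ho
  have key2 : DifferentiableAt ℂ (Function.update u c (limUnder (𝓝[≠] c) u)) c :=
    key.differentiableAt hs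
  refine key2.congr_of_eventuallyEq ?_
  filter_upwards [hs] with z hz
  by_cases h : z = c
  · subst h; simp [remExt]
  · rw [Function.update_of_ne h]
    exact remExt_eq (hsub z hz h).continuousAt

/-- boundary of the square -/
def sqB (ρ : ℝ) : Set ℂ := {z | (|z.re| = ρ ∧ |z.im| ≤ ρ) ∨ (|z.im| = ρ ∧ |z.re| ≤ ρ)}

noncomputable def rectI (g : ℂ → ℂ) (ρ : ℝ) : ℂ :=
  (∫ x in (-ρ)..ρ, g (x + (-ρ : ℝ) * I)) - (∫ x in (-ρ)..ρ, g (x + ρ * I))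
    + I * (∫ y in (-ρ)..ρ, g (ρ + y * I)) - I * (∫ y in (-ρ)..ρ, g ((-ρ : ℝ) + y * I))

lemma mem_sqB_h {ρ : ℝ} (hρ : 0 < ρ) {x y : ℝ} (hx : x ∈ Set.uIcc (-ρ) ρ) (hy : |y| = ρ) :
    ((x : ℂ) + y * I) ∈ sqB ρ := by
  rw [Set.uIcc_of_le (by linarith)] at hx
  right
  simpa [hy] using abs_le.2 hx

lemma mem_sqB_v {ρ : ℝ} (hρ : 0 < ρ) {x y : ℝ} (hx : |x| = ρ) (hy : y ∈ Set.uIcc (-ρ) ρ) :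
    ((x : ℂ) + y * I) ∈ sqB ρ := by
  rw [Set.uIcc_of_le (by linarith)] at hy
  left
  simpa [hx] using abs_le.2 hy

lemma sqB_int_h {g : ℂ → ℂ} {ρ : ℝ} (hρ : 0 < ρ) (hg : ContinuousOn g (sqB ρ)) {y : ℝ}
    (hy : |y| = ρ) : ContinuousOn (fun x : ℝ => g (x + y * I)) (Set.uIcc (-ρ) ρ) :=
  hg.comp (Continuous.continuousOn (by fun_prop)) fun _ hx => mem_sqB_h hρ hx hy

lemma sqB_int_v {g : ℂ → ℂ} {ρ : ℝ} (hρ : 0 < ρ) (hg : ContinuousOn g (sqB ρ)) {x : ℝ}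
    (hx : |x| = ρ) : ContinuousOn (fun y : ℝ => g (x + y * I)) (Set.uIcc (-ρ) ρ) :=
  hg.comp (Continuous.continuousOn (by fun_prop)) fun _ hy => mem_sqB_v hρ hx hy

lemma rectI_add {g k : ℂ → ℂ} {ρ : ℝ} (hρ : 0 < ρ) (hg : ContinuousOn g (sqB ρ))
    (hk : ContinuousOn k (sqB ρ)) :
    rectI (fun z => g z + k z) ρ = rectI g ρ + rectI k ρ := by
  have e1 : |ρ| = ρ := abs_of_pos hρ
  have e2 : |-ρ| = ρ := by rw [abs_neg, e1]
  unfold rectI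
  rw [intervalIntegral.integral_add (sqB_int_h hρ hg e2).intervalIntegrable
      (sqB_int_h hρ hk e2).intervalIntegrable,
    intervalIntegral.integral_add (sqB_int_h hρ hg e1).intervalIntegrable
      (sqB_int_h hρ hk e1).intervalIntegrable,
    intervalIntegral.integral_add (sqB_int_v hρ hg e1).intervalIntegrable
      (sqB_int_v hρ hk e1).intervalIntegrable,
    intervalIntegral.integral_add (sqB_int_v hρ hg e2).intervalIntegrable
      (sqB_int_v hρ hk e2).intervalIntegrable]
  ring

lemma rectI_const_mul (g : ℂ → ℂ) (c : ℂ) (ρ : ℝ) :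
    rectI (fun z => c * g z) ρ = c * rectI g ρ := by
  unfold rectI
  simp only [intervalIntegral.integral_const_mul]
  ring

lemma rectI_congr {g k : ℂ → ℂ} {ρ : ℝ} (hρ : 0 < ρ) (h : ∀ z ∈ sqB ρ, g z = k z) :
    rectI g ρ = rectI k ρ := by
  have e1 : |ρ| = ρ := abs_of_pos hρ
  have e2 : |-ρ| = ρ := by rw [abs_neg, e1]
  unfold rectI
  rw [intervalIntegral.integral_congr (fun x hx => h _ (mem_sqB_h hρ hx e2)),
    intervalIntegral.integral_congr (fun x hx => h _ (mem_sqB_h hρ hx e1)),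
    intervalIntegral.integral_congr (fun x hx => h _ (mem_sqB_v hρ e1 hx)),
    intervalIntegral.integral_congr (fun x hx => h _ (mem_sqB_v hρ e2 hx))]

lemma rectI_zero {g : ℂ → ℂ} {ρ : ℝ} (hρ : 0 < ρ)
    (h : ∀ z : ℂ, |z.re| ≤ ρ → |z.im| ≤ ρ → DifferentiableAt ℂ g z) : rectI g ρ = 0 := by
  have := Complex.integral_boundary_rect_eq_zero_of_differentiableOn g
    ((-ρ : ℝ) + (-ρ : ℝ) * I) (ρ + ρ * I) (by
      intro z hz
      rw [Complex.mem_reProdIm] at hz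
      have e : Set.uIcc (-ρ) ρ = Set.Icc (-ρ) ρ := Set.uIcc_of_le (by linarith)
      obtain ⟨h1, h2⟩ := hz
      simp only [add_re, ofReal_re, mul_re, I_re, mul_zero, ofReal_im, I_im, mul_one, sub_self,
        add_zero, add_im, mul_im, zero_add, e] at h1 h2
      exact (h z (abs_le.2 h1) (abs_le.2 h2)).differentiableWithinAt)
  simpa [rectI] using this

lemma slit_of_im {z : ℂ} (h : z.im ≠ 0) : z ∈ slitPlane := Or.inr h

lemma rectI_inv {ρ ξ : ℝ} (hρ : 0 < ρ) (hξ : |ξ| < ρ) :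
    rectI (fun z => (z - ξ)⁻¹) ρ = 2 * π * I := by
  obtain ⟨h1, h2⟩ := abs_lt.1 hξ
  have hh : ∀ y : ℝ, y ≠ 0 → (∫ x in (-ρ)..ρ, ((x : ℂ) + y * I - ξ)⁻¹) =
      Complex.log (ρ + y * I - ξ) - Complex.log ((-ρ : ℝ) + y * I - ξ) := by
    intro y hy
    have hsl : ∀ x : ℝ, ((x : ℂ) + y * I - ξ) ∈ slitPlane := fun x => slit_of_im (by simpa using hy)
    refine intervalIntegral.integral_eq_sub_of_hasDerivAt (f := fun x : ℝ => Complex.log (x + y * I - ξ)) ?_ ?_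
    · intro x _
      have : HasDerivAt (fun x : ℝ => (x : ℂ) + y * I - ξ) 1 x := by
        simpa using ((Complex.ofRealCLM.hasDerivAt (x := x)).add_const (y * I : ℂ)).sub_const (ξ : ℂ)
      have := this.clog_real (hsl x)
      simpa using this
    · apply Continuous.intervalIntegrable
      refine Continuous.inv₀ (by fun_prop) fun x h => slitPlane_ne_zero (hsl x) h
  have hv : ∀ s x : ℝ, 0 < s * (x - ξ) → s ≠ 0 → I * (∫ y in (-ρ)..ρ, ((x : ℂ) + y * I - ξ)⁻¹) =
      Complex.log (s * (x + ρ * I - ξ)) - Complex.log (s * (x + (-ρ : ℝ) * I - ξ)) := by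
    intro s x hx hs
    have hsl : ∀ y : ℝ, (s * ((x : ℂ) + y * I - ξ)) ∈ slitPlane := fun y => Or.inl (by simpa using hx)
    have hne : ∀ y : ℝ, ((x : ℂ) + y * I - ξ) ≠ 0 := fun y h => slitPlane_ne_zero (hsl y) (by rw [h, mul_zero])
    rw [← intervalIntegral.integral_const_mul]
    refine intervalIntegral.integral_eq_sub_of_hasDerivAt (f := fun y : ℝ => Complex.log (s * (x + y * I - ξ))) ?_ ?_
    · intro y _
      have : HasDerivAt (fun y : ℝ => (s : ℂ) * ((x : ℂ) + y * I - ξ)) (s * I) y := by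
        have := ((((Complex.ofRealCLM.hasDerivAt (x := y)).mul_const I).const_add (x : ℂ)).sub_const (ξ : ℂ)).const_mul (s : ℂ)
        simpa using this
      have := this.clog_real (hsl y)
      have hs' : (s : ℂ) ≠ 0 := by exact_mod_cast hs
      rw [mul_div_mul_left _ _ hs', div_eq_mul_inv] at this
      exact this
    · apply Continuous.intervalIntegrable
      refine continuous_const.mul (Continuous.inv₀ (by fun_prop) hne)
  have e1 := hh (-ρ) (by linarith)
  have e2 := hh ρ (by linarith)
  have e3 := hv 1 ρ (by linarith) one_ne_zero
  have e4 := hv (-1) (-ρ) (by linarith) (by norm_num)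
  unfold rectI
  rw [e1, e2, e3, e4]
  set A : ℂ := ρ + ξ + ρ * I with hA
  have hAim : A.im = ρ := by simp [hA]
  have hA0 : A ≠ 0 := fun h => by rw [h] at hAim; simp at hAim; linarith
  have b1 : ((-ρ : ℝ) : ℂ) + ((-ρ : ℝ) : ℂ) * I - ξ = -A := by rw [hA]; push_cast; ring
  have b2 : ((-ρ : ℝ) : ℂ) + (ρ : ℂ) * I - ξ = -(starRingEnd ℂ A) := by
    rw [hA]; simp; ring
  have b3 : ((-1 : ℝ) : ℂ) * (((-ρ : ℝ) : ℂ) + (ρ : ℂ) * I - ξ) = starRingEnd ℂ A := by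
    rw [hA]; simp; ring
  have b4 : ((-1 : ℝ) : ℂ) * (((-ρ : ℝ) : ℂ) + ((-ρ : ℝ) : ℂ) * I - ξ) = A := by
    rw [hA]; push_cast; ring
  rw [b3, b4, b1, b2]
  have l1 : Complex.log (-A) = Complex.log A - π * I := by
    simp only [Complex.log, norm_neg, Complex.arg_neg_eq_arg_sub_pi_of_im_pos (by rw [hAim]; exact hρ)]
    push_cast; ring
  have l2 : Complex.log (-(starRingEnd ℂ A)) = Complex.log (starRingEnd ℂ A) + π * I := by
    simp only [Complex.log, norm_neg, Complex.arg_neg_eq_arg_add_pi_of_im_neg (x := starRingEnd ℂ A) (by simp [hAim]; exact hρ)]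
    push_cast; ring
  rw [l1, l2]
  simp only [ofReal_one, one_mul]
  ring

lemma sqB_sub {ρ : ℝ} {z : ℂ} (h : z ∈ sqB ρ) : |z.re| ≤ ρ ∧ |z.im| ≤ ρ := by
  rcases h with h | h
  · exact ⟨h.1.le, h.2⟩
  · exact ⟨h.2, h.1.le⟩

lemma sqB_ne {ρ ξ : ℝ} (hξ : |ξ| < ρ) {z : ℂ} (h : z ∈ sqB ρ) : z ≠ ξ := by
  rintro rfl
  have h0 := abs_nonneg ξ
  rcases h with h | h
  · simp at h; linarith [h.1]
  · simp at h; linarith [h.1]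

lemma rectI_sum {ρ : ℝ} (hρ : 0 < ρ) (S : Finset ℝ) (hS : ∀ ξ ∈ S, |ξ| < ρ) (c : ℝ → ℂ) :
    ContinuousOn (fun z : ℂ => ∑ ξ ∈ S, c ξ * (z - ξ)⁻¹) (sqB ρ) ∧
    rectI (fun z : ℂ => ∑ ξ ∈ S, c ξ * (z - ξ)⁻¹) ρ = 2 * π * I * ∑ ξ ∈ S, c ξ := by
  induction S using Finset.induction_on with
  | empty =>
    refine ⟨by simpa using continuousOn_const, ?_⟩
    simp [rectI]
  | insert a S ha ih =>
    obtain ⟨i1, i2⟩ := ih fun ξ h => hS ξ (Finset.mem_insert_of_mem h)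
    have hc : ContinuousOn (fun z : ℂ => c a * (z - a)⁻¹) (sqB ρ) := by
      refine continuousOn_const.mul (ContinuousOn.inv₀ (by fun_prop) fun z hz => ?_)
      exact sub_ne_zero.2 (sqB_ne (hS a (Finset.mem_insert_self _ _)) hz)
    simp only [Finset.sum_insert ha]
    refine ⟨hc.add i1, ?_⟩
    rw [rectI_add hρ hc i1, i2, rectI_const_mul, rectI_inv hρ (hS a (Finset.mem_insert_self _ _))]
    ring

lemma rect_residue {g : ℂ → ℂ} {ρ : ℝ} (hρ : 0 < ρ) (S : Finset ℝ) (hS : ∀ ξ ∈ S, |ξ| < ρ)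
    (c : ℝ → ℂ)
    (hd : ∀ z : ℂ, |z.re| ≤ ρ → |z.im| ≤ ρ → (∀ ξ ∈ S, z ≠ (ξ : ℂ)) →
      ∀ᶠ w in 𝓝 z, DifferentiableAt ℂ g w)
    (hres : ∀ ξ ∈ S, Tendsto (fun z : ℂ => (z - ξ) * g z) (𝓝[≠] (ξ : ℂ)) (𝓝 (c ξ))) :
    rectI g ρ = 2 * π * I * ∑ ξ ∈ S, c ξ := by
  obtain ⟨s1, s2⟩ := rectI_sum hρ S hS c
  set P : ℂ → ℂ := fun z : ℂ => ∑ ξ ∈ S, c ξ * (z - ξ)⁻¹ with hP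
  set u : ℂ → ℂ := fun z => g z - P z with hu
  have hPd : ∀ z : ℂ, (∀ ξ ∈ S, z ≠ (ξ : ℂ)) → DifferentiableAt ℂ P z := by
    intro z hz
    rw [hP]
    refine DifferentiableAt.fun_sum fun ξ hξ => ?_
    exact (differentiableAt_const _).mul (DifferentiableAt.inv (by fun_prop) (sub_ne_zero.2 (hz ξ hξ)))
  have hgood : ∀ z : ℂ, (∀ ξ ∈ S, z ≠ (ξ : ℂ)) → ∀ᶠ w in 𝓝 z, ∀ ξ ∈ S, w ≠ (ξ : ℂ) := by
    intro z hz
    rw [Filter.eventually_all_finset]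
    exact fun ξ hξ => isOpen_ne.mem_nhds (hz ξ hξ)
  have hgood' : ∀ z : ℂ, ∀ᶠ w in 𝓝[≠] z, ∀ ξ ∈ S, w ≠ (ξ : ℂ) := by
    intro z
    rw [Filter.eventually_all_finset]
    intro ξ hξ
    by_cases h : z = ξ
    · subst h; exact self_mem_nhdsWithin
    · exact nhdsWithin_le_nhds (isOpen_ne.mem_nhds h)
  have hv : rectI (remExt u) ρ = 0 := by
    refine rectI_zero hρ fun z h1 h2 => ?_
    by_cases hz : ∀ ξ ∈ S, z ≠ (ξ : ℂ)
    · have hud : ∀ᶠ w in 𝓝 z, DifferentiableAt ℂ u w := by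
        filter_upwards [hd z h1 h2 hz, hgood z hz] with w hw1 hw2
        exact hw1.sub (hPd w hw2)
      refine remExt_diff (nhdsWithin_le_nhds hud) ?_
      have hc : ContinuousAt (fun w => (w - z) * u w) z :=
        (by fun_prop : ContinuousAt (fun w => w - z) z).mul hud.self_of_nhds.continuousAt
      have := hc.tendsto
      simp only [sub_self, zero_mul] at this
      exact this.mono_left nhdsWithin_le_nhds
    · push Not at hz
      obtain ⟨ξ, hξ, rfl⟩ := hz
      have hin : ∀ᶠ w : ℂ in 𝓝 (ξ : ℂ), |w.re| < ρ ∧ |w.im| < ρ := by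
        refine IsOpen.mem_nhds (s := {w : ℂ | |w.re| < ρ ∧ |w.im| < ρ}) ?_ ?_
        · exact (isOpen_lt (Complex.continuous_re.abs) continuous_const).inter
            (isOpen_lt (Complex.continuous_im.abs) continuous_const)
        · simpa using ⟨hS ξ hξ, hρ⟩
      refine remExt_diff ?_ ?_
      · filter_upwards [nhdsWithin_le_nhds hin, hgood' ξ] with w hw1 hw2
        exact (hd w hw1.1.le hw1.2.le hw2).self_of_nhds.sub (hPd w hw2)
      · have hsplit : ∀ z : ℂ, P z = c ξ * (z - ξ)⁻¹ + ∑ η ∈ S.erase ξ, c η * (z - η)⁻¹ := by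
          intro z; rw [hP]; exact (Finset.add_sum_erase _ _ hξ).symm
        have hrest : ContinuousAt (fun z : ℂ => ∑ η ∈ S.erase ξ, c η * (z - η)⁻¹) (ξ : ℂ) := by
          refine DifferentiableAt.continuousAt (𝕜 := ℂ) (DifferentiableAt.fun_sum fun η hη => ?_)
          refine (differentiableAt_const _).mul (DifferentiableAt.inv (by fun_prop) (sub_ne_zero.2 ?_))
          intro h
          exact Finset.ne_of_mem_erase hη (by exact_mod_cast h.symm)
        have t2 : Tendsto (fun w : ℂ => (w - ξ) * ∑ η ∈ S.erase ξ, c η * (w - η)⁻¹) (𝓝[≠] (ξ : ℂ)) (𝓝 0) := by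
          have := ((by fun_prop : ContinuousAt (fun w : ℂ => w - ξ) (ξ : ℂ)).mul hrest).tendsto
          simp only [Pi.mul_apply, sub_self, zero_mul] at this
          exact this.mono_left nhdsWithin_le_nhds
        have t3 := ((hres ξ hξ).sub_const (c ξ)).sub t2
        simp only [sub_self] at t3
        refine t3.congr' ?_
        filter_upwards [self_mem_nhdsWithin] with w hw
        have hw' : w - ξ ≠ 0 := sub_ne_zero.2 hw
        rw [hu]
        simp only [hsplit]
        field_simp
        ring
  have hgc : ContinuousOn g (sqB ρ) := fun z hz =>
    (hd z (sqB_sub hz).1 (sqB_sub hz).2 fun ξ hξ => sqB_ne (hS ξ hξ) hz).self_of_nhds.continuousAt.continuousWithinAt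
  have huc : ∀ z ∈ sqB ρ, ContinuousAt u z := fun z hz =>
    ((hd z (sqB_sub hz).1 (sqB_sub hz).2 fun ξ hξ => sqB_ne (hS ξ hξ) hz).self_of_nhds.sub
      (hPd z fun ξ hξ => sqB_ne (hS ξ hξ) hz)).continuousAt
  have hgeq : rectI g ρ = rectI (fun z => u z + P z) ρ :=
    rectI_congr hρ fun z _ => by rw [hu]; ring
  rw [hgeq, rectI_add hρ (fun z hz => (huc z hz).continuousWithinAt) s1, s2,
    ← rectI_congr hρ (fun z hz => remExt_eq (huc z hz)), hv, zero_add]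


lemma al_pos : 0 < invSqrt2 := by unfold invSqrt2; positivity
lemma al_sq : invSqrt2 ^ 2 = 1 / 2 := by unfold invSqrt2; rw [inv_pow, Real.sq_sqrt (by norm_num)]; norm_num
lemma al_sqrt : Real.sqrt 2 * invSqrt2 = 1 := by unfold invSqrt2; exact mul_inv_cancel₀ (by positivity)
lemma al_lt : invSqrt2 < 1 := by nlinarith [al_sq, al_pos]
lemma sin_al_pos : 0 < Real.sin invSqrt2 :=
  Real.sin_pos_of_pos_of_lt_pi al_pos (by linarith [al_lt, Real.pi_gt_three])
lemma cos_al_ge : 3 / 4 ≤ Real.cos invSqrt2 := by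
  have := Real.one_sub_sq_div_two_le_cos (x := invSqrt2)
  rw [al_sq] at this; linarith

noncomputable def kap : ℝ := Real.sqrt 2 * π * (Real.cos invSqrt2 / Real.sin invSqrt2)
noncomputable def lam : ℝ := invSqrt2 * (Real.cos invSqrt2 / Real.sin invSqrt2) - 1 / 2

lemma kap_pos : 0 < kap := by
  have := sin_al_pos
  have := cos_al_ge
  have h : 0 < Real.cos invSqrt2 := by linarith
  unfold kap; positivity

lemma lam_eq : lam = (kap - π) / (2 * π) := by
  unfold lam kap
  have h : Real.sqrt 2 = 2 * invSqrt2 := by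
    have := al_sqrt
    have h2 := al_sq
    have h3 : Real.sqrt 2 * (invSqrt2 ^ 2) = invSqrt2 := by rw [pow_two, ← mul_assoc, this, one_mul]
    rw [h2] at h3; linarith
  have := sin_al_pos.ne'
  rw [h]
  field_simp

lemma lam_pos : 0 < lam := by
  unfold lam
  have hs := sin_al_pos
  have := Real.sin_le al_pos.le
  have hc := cos_al_ge
  have h : 1 / 2 < invSqrt2 * (Real.cos invSqrt2 / Real.sin invSqrt2) := by
    rw [← mul_div_assoc, lt_div_iff₀ hs]
    nlinarith [al_pos]
  linarith

noncomputable def hF (z : ℂ) : ℂ := Complex.cos (π * z) - kap * z * Complex.sin (π * z)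
noncomputable def tF (z : ℂ) : ℂ := -(kap * z * Complex.cos (π * z) + Complex.sin (π * z))

lemma hF_diff : Differentiable ℂ hF := by unfold hF; fun_prop
lemma tF_diff : Differentiable ℂ tF := by unfold tF; fun_prop

lemma hF_neg (z : ℂ) : hF (-z) = hF z := by unfold hF; simp
lemma tF_neg (z : ℂ) : tF (-z) = -tF z := by unfold tF; simp; ring

lemma hF_zero : hF 0 = 1 := by simp [hF]
lemma tF_zero : tF 0 = 0 := by simp [tF]

lemma hF_hasDeriv (z : ℂ) : HasDerivAt hF (π * tF z - kap * Complex.sin (π * z)) z := by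
  have h1 : HasDerivAt (fun z : ℂ => (π : ℂ) * z) (π : ℂ) z := by
    simpa using (hasDerivAt_id z).const_mul (π : ℂ)
  have h2 : HasDerivAt (fun z : ℂ => (kap : ℂ) * z) (kap : ℂ) z := by
    simpa using (hasDerivAt_id z).const_mul (kap : ℂ)
  have := h1.ccos.sub (h2.mul h1.csin)
  have e : (-Complex.sin (π * z) * π - (kap * Complex.sin (π * z) + kap * z * (Complex.cos (π * z) * π)) : ℂ)
      = π * tF z - kap * Complex.sin (π * z) := by unfold tF; ring
  rw [← e]
  exact this

lemma tF_hasDeriv0 : HasDerivAt tF (-(kap + π)) 0 := by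
  have h1 : HasDerivAt (fun z : ℂ => (π : ℂ) * z) (π : ℂ) 0 := by
    simpa using (hasDerivAt_id (0 : ℂ)).const_mul (π : ℂ)
  have h2 : HasDerivAt (fun z : ℂ => (kap : ℂ) * z) (kap : ℂ) 0 := by
    simpa using (hasDerivAt_id (0 : ℂ)).const_mul (kap : ℂ)
  have := ((h2.mul h1.ccos).add h1.csin).neg
  have e : -((kap : ℂ) * Complex.cos (π * 0) + kap * 0 * (-Complex.sin (π * 0) * π) + Complex.cos (π * 0) * π)
      = -(kap + π) := by simp
  rw [← e]
  exact this

lemma two_hF (z : ℂ) : 2 * hF z = Complex.exp (-(π * z * I)) * (1 - kap * z * I) +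
    Complex.exp (π * z * I) * (1 + kap * z * I) := by
  unfold hF
  rw [← neg_mul, ← Complex.cos_sub_sin_I, ← Complex.cos_add_sin_I]
  have := Complex.I_sq
  linear_combination (-2 * kap * z * Complex.sin (π * z)) * this

lemma norm_exp_pi (z : ℂ) : ‖Complex.exp (π * z * I)‖ = Real.exp (-(π * z.im)) := by
  rw [Complex.norm_exp]; simp
lemma norm_exp_pi' (z : ℂ) : ‖Complex.exp (-(π * z * I))‖ = Real.exp (π * z.im) := by
  rw [Complex.norm_exp]; simp

lemma norm_cmp {z : ℂ} (hz : 0 ≤ z.im) : ‖1 + kap * z * I‖ ≤ ‖1 - kap * z * I‖ := by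
  rw [Complex.norm_def, Complex.norm_def]
  apply Real.sqrt_le_sqrt
  have := kap_pos
  have : 0 ≤ kap * z.im := by positivity
  simp [Complex.normSq_apply]
  nlinarith

lemma norm_hF_ge {z : ℂ} (hz : 0 ≤ z.im) :
    ‖1 - kap * z * I‖ * (Real.exp (π * z.im) - Real.exp (-(π * z.im))) ≤ 2 * ‖hF z‖ := by
  have h : 2 * ‖hF z‖ = ‖2 * hF z‖ := by simp
  rw [h, two_hF]
  have h1 := norm_sub_norm_le (Complex.exp (-(π * z * I)) * (1 - kap * z * I))
    (-(Complex.exp (π * z * I) * (1 + kap * z * I)))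
  rw [sub_neg_eq_add, norm_neg, norm_mul, norm_mul, norm_exp_pi, norm_exp_pi'] at h1
  have h2 := mul_le_mul_of_nonneg_left (norm_cmp hz) (Real.exp_pos (-(π * z.im))).le
  linarith

lemma norm_one_sub_ge (z : ℂ) : 1 + kap * z.im ≤ ‖1 - kap * z * I‖ := by
  have := Complex.re_le_norm (1 - kap * z * I)
  simpa using this

lemma hF_ne_upper {z : ℂ} (hz : 0 < z.im) : hF z ≠ 0 := by
  intro h
  have h1 := norm_hF_ge hz.le
  rw [h, norm_zero, mul_zero] at h1
  have h2 := norm_one_sub_ge z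
  have h3 : 0 < kap * z.im := mul_pos kap_pos hz
  have h4 : Real.exp (-(π * z.im)) < Real.exp (π * z.im) := by
    apply Real.exp_lt_exp.2; have : 0 < π * z.im := by positivity
    linarith
  nlinarith

lemma hF_real {z : ℂ} (h : hF z = 0) : z.im = 0 := by
  rcases lt_trichotomy z.im 0 with h1 | h1 | h1
  · exact absurd (by rw [hF_neg, h]) (hF_ne_upper (z := -z) (by simpa using h1))
  · exact h1
  · exact absurd h (hF_ne_upper h1)

lemma hF_ofReal (x : ℝ) : hF x = ((Real.cos (π * x) - kap * x * Real.sin (π * x) : ℝ) : ℂ) := by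
  unfold hF; push_cast; rfl

lemma zero_ge_aux {x : ℝ} (hx : 0 ≤ x) (h : hF x = 0) : 1 ≤ 2 * π ^ 2 * x ^ 2 := by
  rw [hF_ofReal, Complex.ofReal_eq_zero] at h
  by_contra hc
  push Not at hc
  have hpx : π * x < invSqrt2 := by
    have : (π * x) ^ 2 < invSqrt2 ^ 2 := by rw [al_sq]; nlinarith
    exact lt_of_pow_lt_pow_left₀ 2 al_pos.le this
  have h0 : 0 ≤ π * x := by positivity
  have hpi : invSqrt2 < π / 2 := by linarith [al_lt, Real.pi_gt_three]
  have hs := sin_al_pos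
  have c1 : Real.cos invSqrt2 < Real.cos (π * x) :=
    Real.cos_lt_cos_of_nonneg_of_le_pi h0 (by linarith) hpx
  have s1 : Real.sin (π * x) ≤ Real.sin invSqrt2 :=
    Real.sin_le_sin_of_le_of_le_pi_div_two (by linarith) hpi.le hpx.le
  have s0 : 0 ≤ Real.sin (π * x) := Real.sin_nonneg_of_nonneg_of_le_pi h0 (by linarith)
  have k1 : kap * x ≤ Real.cos invSqrt2 / Real.sin invSqrt2 := by
    have e : kap * x = (Real.sqrt 2 * (π * x)) * (Real.cos invSqrt2 / Real.sin invSqrt2) := by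
      unfold kap; ring
    rw [e]
    have : Real.sqrt 2 * (π * x) ≤ 1 := by
      rw [← al_sqrt]; exact mul_le_mul_of_nonneg_left hpx.le (by positivity)
    have hc := cos_al_ge
    have : 0 ≤ Real.cos invSqrt2 / Real.sin invSqrt2 := by apply div_nonneg <;> linarith
    nlinarith
  have h3 : kap * x * Real.sin (π * x) ≤ Real.cos invSqrt2 / Real.sin invSqrt2 * Real.sin invSqrt2 :=
    mul_le_mul k1 s1 s0 (div_nonneg (by linarith [cos_al_ge]) hs.le)
  rw [div_mul_cancel₀ _ hs.ne'] at h3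
  linarith

lemma zero_ge {x : ℝ} (h : hF x = 0) : 1 ≤ 2 * π ^ 2 * x ^ 2 := by
  rcases le_total 0 x with hx | hx
  · exact zero_ge_aux hx h
  · have := zero_ge_aux (x := -x) (by linarith) (by push_cast; rw [hF_neg, h])
    simpa using this

lemma zero_al : hF ((invSqrt2 / π : ℝ) : ℂ) = 0 := by
  rw [hF_ofReal, Complex.ofReal_eq_zero]
  have e : π * (invSqrt2 / π) = invSqrt2 := by field_simp
  have e2 : kap * (invSqrt2 / π) = (Real.sqrt 2 * invSqrt2) * (Real.cos invSqrt2 / Real.sin invSqrt2) := by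
    unfold kap; field_simp
  rw [e, e2, al_sqrt, one_mul, div_mul_cancel₀ _ sin_al_pos.ne', sub_self]

/-- residue weight of the cotangent-like factor -/
noncomputable def rr (x : ℝ) : ℝ := (1 + kap ^ 2 * x ^ 2) / (π * (1 + kap ^ 2 * x ^ 2) + kap)

lemma rr_pos (x : ℝ) : 0 < rr x := by have := kap_pos; unfold rr; positivity

lemma zero_deriv {x : ℝ} (h : hF x = 0) :
    (π * tF x - kap * Complex.sin (π * x)) ≠ 0 ∧
      tF x / (π * tF x - kap * Complex.sin (π * x)) = rr x := by
  have hr : Real.cos (π * x) = kap * x * Real.sin (π * x) := by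
    rw [hF_ofReal, Complex.ofReal_eq_zero] at h; linarith
  have hs : Real.sin (π * x) ≠ 0 := by
    intro h0
    have := Real.sin_sq_add_cos_sq (π * x)
    rw [hr, h0] at this; norm_num at this
  have ht : tF x = ((-(Real.sin (π * x)) * (1 + kap ^ 2 * x ^ 2) : ℝ) : ℂ) := by
    unfold tF
    have : Complex.cos (π * x) = ((Real.cos (π * x) : ℝ) : ℂ) := by push_cast; rfl
    rw [this, hr]; push_cast; ring
  have hd : π * tF x - kap * Complex.sin (π * x) =
      ((-(Real.sin (π * x)) * (π * (1 + kap ^ 2 * x ^ 2) + kap) : ℝ) : ℂ) := by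
    rw [ht]; push_cast; ring
  have hk := kap_pos
  have hp : π * (1 + kap ^ 2 * x ^ 2) + kap ≠ 0 := by positivity
  rw [hd]
  refine ⟨?_, ?_⟩
  · exact_mod_cast mul_ne_zero (neg_ne_zero.2 hs) hp
  · rw [ht, ← Complex.ofReal_div]
    congr 1
    unfold rr
    rw [mul_div_mul_left _ _ (neg_ne_zero.2 hs)]

/-- half-integer radius -/
noncomputable def rho (n : ℕ) : ℝ := n + 1 + 1 / 2

lemma rho_ge (n : ℕ) : 3 / 2 ≤ rho n := by
  unfold rho; have : (0:ℝ) ≤ n := n.cast_nonneg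
  linarith
lemma rho_pos (n : ℕ) : 0 < rho n := by linarith [rho_ge n]

lemma cos_rho (n : ℕ) : Real.cos (π * rho n) = 0 := by
  rw [Real.cos_eq_zero_iff]
  exact ⟨n + 1, by unfold rho; push_cast; ring⟩

lemma abs_sin_rho (n : ℕ) : |Real.sin (π * rho n)| = 1 := by
  have := Real.sin_sq_add_cos_sq (π * rho n)
  rw [cos_rho] at this
  have h : Real.sin (π * rho n) ^ 2 = 1 := by linarith
  exact (sq_eq_one_iff_of_side h)
where sq_eq_one_iff_of_side {a : ℝ} (h : a ^ 2 = 1) : |a| = 1 := by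
        rw [← sq_abs] at h
        nlinarith [abs_nonneg a]

lemma hF_ge_side (n : ℕ) (y : ℝ) :
    kap / 4 * rho n * Real.exp (π * |y|) ≤ ‖hF (rho n + y * I)‖ := by
  have h1 : (π : ℂ) * (rho n + y * I) = ((π * rho n : ℝ) : ℂ) + ((π * y : ℝ) : ℂ) * I := by push_cast; ring
  have e : hF (rho n + y * I) = -((Real.sin (π * rho n) : ℝ) : ℂ) *
      (((Real.sinh (π * y) : ℝ) : ℂ) * I + kap * (rho n + y * I) * ((Real.cosh (π * y) : ℝ) : ℂ)) := by
    unfold hF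
    rw [h1, Complex.sin_add_mul_I, Complex.cos_add_mul_I]
    have : Complex.cos ((π * rho n : ℝ) : ℂ) = 0 := by rw [← Complex.ofReal_cos, cos_rho]; simp
    rw [this, Complex.ofReal_sin, Complex.ofReal_sinh, Complex.ofReal_cosh]; ring
  rw [e, norm_mul, norm_neg, Complex.norm_real, Real.norm_eq_abs, abs_sin_rho, one_mul]
  refine le_trans ?_ (Complex.re_le_norm _)
  have hre : (((Real.sinh (π * y) : ℝ) : ℂ) * I + kap * (rho n + y * I) * ((Real.cosh (π * y) : ℝ) : ℂ)).re
      = kap * rho n * Real.cosh (π * y) := by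
    simp only [add_re, mul_re, ofReal_re, ofReal_im, I_re, I_im, mul_im, add_im]; ring
  rw [hre]
  have hk := kap_pos
  have hr := rho_pos n
  have : Real.exp (π * |y|) / 4 ≤ Real.cosh (π * y) := by
    have e1 : π * |y| = |π * y| := by rw [abs_mul, abs_of_pos Real.pi_pos]
    rw [e1, ← Real.cosh_abs, Real.cosh_eq]
    have := Real.exp_pos (|π * y|)
    have := Real.exp_pos (-|π * y|)
    linarith
  calc kap / 4 * rho n * Real.exp (π * |y|) = kap * rho n * (Real.exp (π * |y|) / 4) := by ring
    _ ≤ _ := by gcongr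

lemma hF_ge_top (n : ℕ) {z : ℂ} (hz : z.im = rho n) :
    kap / 4 * rho n * Real.exp (π * |z.im|) ≤ ‖hF z‖ := by
  have hr := rho_ge n
  have hk := kap_pos
  have h1 := norm_hF_ge (z := z) (by linarith)
  have h2 := norm_one_sub_ge z
  rw [hz] at h1 h2 ⊢
  rw [abs_of_pos (by linarith)]
  have h3 : Real.exp (-(π * rho n)) ≤ Real.exp (π * rho n) / 2 := by
    have a1 : Real.exp (-(π * rho n)) ≤ 1 := Real.exp_le_one_iff.2 (by have := rho_pos n; simp; positivity)
    have a2 := Real.add_one_le_exp (π * rho n)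
    nlinarith [Real.pi_gt_three]
  have h4 : kap * rho n * (Real.exp (π * rho n) / 2) ≤
      ‖1 - kap * z * I‖ * (Real.exp (π * rho n) - Real.exp (-(π * rho n))) := by
    apply mul_le_mul
    · linarith
    · linarith
    · have := Real.exp_pos (π * rho n); linarith
    · exact norm_nonneg _
  linarith

lemma hF_ge {n : ℕ} {z : ℂ} (hz : z ∈ sqB (rho n)) :
    kap / 4 * rho n * Real.exp (π * |z.im|) ≤ ‖hF z‖ := by
  have hr := rho_pos n
  rcases hz with ⟨h, -⟩ | ⟨h, -⟩
  · rcases (abs_eq hr.le).1 h with h | h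
    · have := hF_ge_side n z.im
      rw [← h, Complex.re_add_im] at this
      rwa [h] at this
    · have := hF_ge_side n (-z.im)
      rw [← hF_neg] at this
      have e : -((rho n : ℂ) + ((-z.im : ℝ) : ℂ) * I) = z := by
        have : rho n = -z.re := by linarith
        rw [this]; push_cast
        linear_combination Complex.re_add_im z
      rwa [e, abs_neg] at this
  · rcases (abs_eq hr.le).1 h with h | h
    · exact hF_ge_top n h
    · have := hF_ge_top n (z := -z) (by simp [h])
      rwa [hF_neg, Complex.neg_im, abs_neg] at this

lemma hF_ne_sqB {n : ℕ} {z : ℂ} (hz : z ∈ sqB (rho n)) : hF z ≠ 0 := by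
  have h := hF_ge hz
  have := kap_pos
  have := rho_pos n
  have : 0 < kap / 4 * rho n * Real.exp (π * |z.im|) := by positivity
  exact norm_pos_iff.1 (by linarith)


noncomputable def sC : ℂ → ℂ := dslope Complex.sin 0

lemma sC_diff : Differentiable ℂ sC := by
  have := (Complex.differentiableOn_dslope (s := Set.univ) (c := (0:ℂ)) (f := Complex.sin) Filter.univ_mem).2
    Complex.differentiable_sin.differentiableOn
  exact differentiableOn_univ.1 this

lemma sC_zero : sC 0 = 1 := by simp [sC]

lemma sC_mul (z : ℂ) : z * sC z = Complex.sin z := by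
  have := sub_smul_dslope Complex.sin 0 z
  simpa [sC] using this

lemma sC_ne {z : ℂ} (hz : z ≠ 0) : sC z = Complex.sin z / z := by
  rw [← sC_mul z]; field_simp

noncomputable def Wf (z : ℂ) : ℂ := 1 - sC (π * z) ^ 2

lemma Wf_diff : Differentiable ℂ Wf := by
  unfold Wf
  have : Differentiable ℂ fun z : ℂ => sC (π * z) := sC_diff.comp (by fun_prop)
  exact (differentiable_const _).sub (this.pow 2)

noncomputable def mF (z : ℂ) : ℂ :=
  ((2 * π ^ 2 * z ^ 2 - 1) * (tF z / hF z) - Complex.sin (2 * π * z)) / (2 * π ^ 2 * z ^ 2)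

lemma pi_ne : (π : ℂ) ≠ 0 := by exact_mod_cast Real.pi_ne_zero

lemma mF_diffAt {z : ℂ} (h0 : z ≠ 0) (h : hF z ≠ 0) : DifferentiableAt ℂ mF z := by
  unfold mF
  have hp : 2 * (π : ℂ) ^ 2 * z ^ 2 ≠ 0 := mul_ne_zero (mul_ne_zero two_ne_zero (pow_ne_zero 2 pi_ne)) (pow_ne_zero 2 h0)
  refine DifferentiableAt.div ?_ (by fun_prop) hp
  refine DifferentiableAt.sub (DifferentiableAt.mul (by fun_prop) ?_) (by fun_prop)
  exact (tF_diff z).div (hF_diff z) h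

lemma mF_up {z : ℂ} (h0 : z ≠ 0) (h : hF z ≠ 0) :
    mF z + I * Wf z = (2 * π ^ 2 * z ^ 2 - 1) / (2 * π ^ 2 * z ^ 2) *
      ((I - kap * z) * Complex.exp (π * z * I) / hF z)
      + I * Complex.exp (π * z * I) ^ 2 / (2 * π ^ 2 * z ^ 2) := by
  have hp := pi_ne
  have e1 : (I - kap * z) * Complex.exp (π * z * I) = tF z + I * hF z := by
    rw [← Complex.cos_add_sin_I]; unfold tF hF
    linear_combination (Complex.sin (π * z)) * I_sq
  have e2 : (I - kap * z) * Complex.exp (π * z * I) / hF z = tF z / hF z + I := by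
    rw [e1]; field_simp
  rw [e2]
  unfold mF Wf
  rw [sC_ne (mul_ne_zero hp h0), ← Complex.cos_add_sin_I,
    show (2 : ℂ) * π * z = 2 * (π * z) by ring, Complex.sin_two_mul]
  set T := tF z / hF z
  set s := Complex.sin (π * z) with hs
  set c := Complex.cos (π * z) with hc
  have hsc : s ^ 2 + c ^ 2 = 1 := Complex.sin_sq_add_cos_sq _
  have hI := I_sq
  field_simp
  linear_combination (-I) * hsc + (- I * s ^ 2 - 2 * s * c) * hI

noncomputable def bC : ℝ := 2 * (4 / kap + 8) + 1

lemma sqB_norm_ge {ρ : ℝ} {z : ℂ} (hz : z ∈ sqB ρ) : ρ ≤ ‖z‖ := by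
  rcases hz with h | h
  · rw [← h.1]; exact Complex.abs_re_le_norm z
  · rw [← h.1]; exact Complex.abs_im_le_norm z

lemma sqB_norm_le {ρ : ℝ} {z : ℂ} (hz : z ∈ sqB ρ) : ‖z‖ ≤ 2 * ρ := by
  have := Complex.norm_le_abs_re_add_abs_im z
  have := sqB_sub hz
  linarith [this.1, this.2]

lemma mF_up_bound {n : ℕ} {z : ℂ} (hz : z ∈ sqB (rho n)) (hi : 0 ≤ z.im) :
    ‖mF z + I * Wf z‖ ≤ bC * Real.exp (-(2 * π * z.im)) := by
  have hn := sqB_norm_ge hz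
  have hr := rho_ge n
  have hk := kap_pos
  have h0 : z ≠ 0 := norm_pos_iff.1 (by linarith)
  have hp := pi_ne
  rw [mF_up h0 (hF_ne_sqB hz)]
  have hE : Real.exp (-(2 * π * z.im)) = Real.exp (-(π * z.im)) ^ 2 := by
    rw [← Real.exp_nat_mul]; congr 1; push_cast; ring
  have hd : (1:ℝ) ≤ ‖2 * (π:ℂ) ^ 2 * z ^ 2‖ := by
    simp only [norm_mul, norm_pow, Complex.norm_real, Real.norm_eq_abs, abs_of_pos Real.pi_pos,
      Complex.norm_ofNat]
    have : 1 ≤ ‖z‖ ^ 2 := by nlinarith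
    have : 9 ≤ π ^ 2 := by nlinarith [Real.pi_gt_three]
    nlinarith
  have b1 : ‖(2 * (π:ℂ) ^ 2 * z ^ 2 - 1) / (2 * π ^ 2 * z ^ 2)‖ ≤ 2 := by
    rw [norm_div, div_le_iff₀ (by linarith)]
    have := norm_sub_le (2 * (π:ℂ) ^ 2 * z ^ 2) 1
    rw [norm_one] at this; linarith
  have b2 : ‖(I - kap * z) * Complex.exp (π * z * I) / hF z‖ ≤ (4 / kap + 8) * Real.exp (-(2 * π * z.im)) := by
    have hh := hF_ge hz
    rw [abs_of_nonneg hi] at hh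
    have hpos : 0 < kap / 4 * rho n * Real.exp (π * z.im) := by have := rho_pos n; positivity
    rw [norm_div, norm_mul, norm_exp_pi, div_le_iff₀ (by linarith)]
    have c1 : ‖I - kap * z‖ ≤ 1 + kap * (2 * rho n) := by
      have := norm_sub_le I (kap * z)
      rw [Complex.norm_I, norm_mul, Complex.norm_real, Real.norm_eq_abs, abs_of_pos hk] at this
      have := mul_le_mul_of_nonneg_left (sqB_norm_le hz) hk.le
      linarith
    have c2 : 1 + kap * (2 * rho n) ≤ (4 / kap + 8) * (kap / 4 * rho n) := by
      have : (4 / kap + 8) * (kap / 4 * rho n) = rho n + 2 * kap * rho n := by field_simp; ring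
      rw [this]; linarith
    have hee : Real.exp (-(π * z.im)) * Real.exp (π * z.im) = 1 := by
      rw [← Real.exp_add]; simp
    calc ‖I - kap * z‖ * Real.exp (-(π * z.im)) ≤
        ((4 / kap + 8) * (kap / 4 * rho n)) * Real.exp (-(π * z.im)) := by
          gcongr; linarith
      _ = (4 / kap + 8) * Real.exp (-(2 * π * z.im)) * (kap / 4 * rho n * Real.exp (π * z.im)) := by
          rw [hE]; linear_combination (-(4 / kap + 8) * (kap / 4 * rho n) * Real.exp (-(π * z.im))) * hee
      _ ≤ _ := by gcongr
  have b3 : ‖I * Complex.exp (π * z * I) ^ 2 / (2 * π ^ 2 * z ^ 2)‖ ≤ Real.exp (-(2 * π * z.im)) := by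
    rw [norm_div, norm_mul, norm_pow, Complex.norm_I, one_mul, norm_exp_pi, ← hE]
    exact div_le_self (Real.exp_pos _).le hd
  calc _ ≤ _ := norm_add_le _ _
    _ ≤ 2 * ((4 / kap + 8) * Real.exp (-(2 * π * z.im))) + Real.exp (-(2 * π * z.im)) := by
        rw [norm_mul]; gcongr
    _ = _ := by unfold bC; ring

lemma sC_neg (z : ℂ) : sC (-z) = sC z := by
  by_cases h : z = 0
  · simp [h]
  · rw [sC_ne h, sC_ne (neg_ne_zero.2 h), Complex.sin_neg, neg_div_neg_eq]

lemma Wf_neg (z : ℂ) : Wf (-z) = Wf z := by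
  unfold Wf; rw [mul_neg, sC_neg]

lemma mF_neg (z : ℂ) : mF (-z) = - mF z := by
  unfold mF; rw [hF_neg, tF_neg, mul_neg, Complex.sin_neg, neg_sq, neg_div, neg_div']
  ring

lemma sqB_neg {ρ : ℝ} {z : ℂ} (hz : z ∈ sqB ρ) : -z ∈ sqB ρ := by
  unfold sqB at *; simpa using hz

lemma mF_down_bound {n : ℕ} {z : ℂ} (hz : z ∈ sqB (rho n)) (hi : z.im ≤ 0) :
    ‖mF z - I * Wf z‖ ≤ bC * Real.exp (2 * π * z.im) := by
  have := mF_up_bound (sqB_neg hz) (by simpa using hi)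
  rw [mF_neg, Wf_neg, ← norm_neg] at this
  have e : -(-mF z + I * Wf z) = mF z - I * Wf z := by ring
  have e2 : -(2 * π * (-z).im) = 2 * π * z.im := by simp
  rwa [e, e2] at this

lemma bC_pos : 0 < bC := by have := kap_pos; unfold bC; positivity

lemma zeros_finite (ρ : ℝ) : {x : ℝ | |x| < ρ ∧ hF x = 0}.Finite := by
  have hA : AnalyticOnNhd ℂ hF Set.univ := fun z _ => hF_diff.analyticAt z
  have h1 : {z : ℂ | ‖z‖ ≤ ρ ∧ hF z = 0}.Finite := by
    by_contra hinf
    obtain ⟨x, -, hx⟩ := Set.Infinite.exists_accPt_of_subset_isCompact hinf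
      (isCompact_closedBall (0:ℂ) ρ) (fun z hz => by simpa using hz.1)
    rw [accPt_iff_frequently_nhdsNE] at hx
    have := hA.eqOn_zero_of_preconnected_of_frequently_eq_zero isPreconnected_univ (Set.mem_univ x)
      (hx.mono fun z hz => hz.2)
    have h0 := this (Set.mem_univ 0)
    rw [hF_zero] at h0
    simp at h0
  have h2 := h1.preimage (f := fun x : ℝ => (x : ℂ)) Complex.ofReal_injective.injOn
  refine h2.subset fun x hx => ?_
  simpa using ⟨hx.1.le, hx.2⟩

noncomputable def zS (n : ℕ) : Finset ℝ := (zeros_finite (rho n)).toFinset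

lemma mem_zS {n : ℕ} {x : ℝ} : x ∈ zS n ↔ |x| < rho n ∧ hF x = 0 := by simp [zS]

noncomputable def cc (x : ℝ) : ℝ := π * (1 - 1 / (2 * π ^ 2 * x ^ 2)) * rr x

lemma cc_nonneg {x : ℝ} (h : hF x = 0) : 0 ≤ cc x := by
  have h1 := zero_ge h
  have := rr_pos x
  have : 1 / (2 * π ^ 2 * x ^ 2) ≤ 1 := by rw [div_le_one (by linarith)]; exact h1
  have h3 : 0 ≤ 1 - 1 / (2 * π ^ 2 * x ^ 2) := by linarith
  unfold cc; positivity

lemma cc_pos {x : ℝ} (h : hF x = 0) (h' : 2 * π ^ 2 * x ^ 2 ≠ 1) : 0 < cc x := by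
  have h1 := lt_of_le_of_ne (zero_ge h) h'.symm
  have := rr_pos x
  have : 1 / (2 * π ^ 2 * x ^ 2) < 1 := by rw [div_lt_one (by linarith)]; exact h1
  have h3 : 0 < 1 - 1 / (2 * π ^ 2 * x ^ 2) := by linarith
  unfold cc; positivity

lemma cc_zero {x : ℝ} (h' : 2 * π ^ 2 * x ^ 2 = 1) : cc x = 0 := by
  unfold cc; rw [h']; simp

lemma zero_not_mem (n : ℕ) : (0 : ℝ) ∉ zS n := by
  rw [mem_zS]; simp [hF_zero]

lemma entire_dslope {f : ℂ → ℂ} (hf : Differentiable ℂ f) (c : ℂ) : Differentiable ℂ (dslope f c) := by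
  have := (Complex.differentiableOn_dslope (s := Set.univ) (c := c) (f := f) Filter.univ_mem).2
    hf.differentiableOn
  exact differentiableOn_univ.1 this

lemma res_zero {f : ℂ → ℂ} (hf : Differentiable ℂ f) :
    Tendsto (fun z : ℂ => (z - (0:ℝ)) * (f z * mF z)) (𝓝[≠] ((0:ℝ) : ℂ)) (𝓝 (lam / π * f 0)) := by
  have hp := pi_ne
  set G : ℂ → ℂ := fun z => f z * (((2 * π ^ 2 * z ^ 2 - 1) * (dslope tF 0 z / hF z)
    - 2 * π * sC (2 * π * z)) / (2 * π ^ 2)) with hG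
  have hc : ContinuousAt G 0 := by
    have h1 : ContinuousAt (dslope tF 0) 0 := (entire_dslope tF_diff 0).continuous.continuousAt
    have h2 : ContinuousAt hF 0 := hF_diff.continuous.continuousAt
    have h3 : ContinuousAt (fun z : ℂ => sC (2 * π * z)) 0 :=
      (sC_diff.continuous.comp (by fun_prop : Continuous fun z : ℂ => 2 * π * z)).continuousAt
    have h4 : ContinuousAt (fun z : ℂ => dslope tF 0 z / hF z) 0 := h1.div h2 (by simp [hF_zero])
    have h5 : ContinuousAt f 0 := hf.continuous.continuousAt
    rw [hG]
    fun_prop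
  have hv : G 0 = lam / π * f 0 := by
    rw [hG]
    simp only [dslope_same, tF_hasDeriv0.deriv, hF_zero, mul_zero, sC_zero]
    rw [lam_eq]; push_cast
    field_simp
    ring
  rw [← hv]
  simp only [Complex.ofReal_zero, sub_zero]
  refine (hc.tendsto.mono_left nhdsWithin_le_nhds).congr' ?_
  filter_upwards [self_mem_nhdsWithin] with z hz
  have hz' : z ≠ 0 := hz
  have e1 : tF z = z * dslope tF 0 z := by
    have := sub_smul_dslope tF 0 z
    rw [tF_zero] at this; simpa using this.symm
  have e2 := sC_mul (2 * π * z)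
  rw [hG]
  unfold mF
  rw [e1, ← e2]
  field_simp

lemma res_node {f : ℂ → ℂ} (hf : Differentiable ℂ f) {x : ℝ} (h : hF x = 0) :
    Tendsto (fun z : ℂ => (z - x) * (f z * mF z)) (𝓝[≠] (x : ℂ)) (𝓝 (cc x / π * f x)) := by
  have hp := pi_ne
  have hx0 : (x : ℂ) ≠ 0 := by
    intro h0; rw [h0, hF_zero] at h; simp at h
  obtain ⟨d1, d2⟩ := zero_deriv h
  set G : ℂ → ℂ := fun z => f z * (((2 * π ^ 2 * z ^ 2 - 1) * (tF z / dslope hF x z)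
    - (z - x) * Complex.sin (2 * π * z)) / (2 * π ^ 2 * z ^ 2)) with hG
  have hval : dslope hF x x = π * tF x - kap * Complex.sin (π * x) := by
    rw [dslope_same, (hF_hasDeriv x).deriv]
  have hc : ContinuousAt G x := by
    have h1 : ContinuousAt (dslope hF x) x := (entire_dslope hF_diff x).continuous.continuousAt
    have h2 : ContinuousAt tF x := tF_diff.continuous.continuousAt
    have h4 : ContinuousAt (fun z : ℂ => tF z / dslope hF x z) x := h2.div h1 (by rw [hval]; exact d1)
    have h5 : ContinuousAt f x := hf.continuous.continuousAt
    rw [hG]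
    refine h5.mul (ContinuousAt.div ?_ (by fun_prop)
      (mul_ne_zero (mul_ne_zero two_ne_zero (pow_ne_zero 2 hp)) (pow_ne_zero 2 hx0)))
    refine ContinuousAt.sub (ContinuousAt.mul (by fun_prop) h4) (by fun_prop)
  have hv : G x = cc x / π * f x := by
    rw [hG]
    simp only [hval, d2, sub_self, zero_mul, sub_zero]
    unfold cc; push_cast
    field_simp
  rw [← hv]
  refine (hc.tendsto.mono_left nhdsWithin_le_nhds).congr' ?_
  have hne : ∀ᶠ z in 𝓝 (x : ℂ), z ≠ 0 := isOpen_ne.mem_nhds hx0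
  filter_upwards [self_mem_nhdsWithin, nhdsWithin_le_nhds hne] with z hz hz0
  have hz' : z - x ≠ 0 := sub_ne_zero.2 hz
  have e1 : hF z = (z - x) * dslope hF x z := by
    have := sub_smul_dslope hF x z
    rw [h] at this; simpa using this.symm
  rw [hG]
  unfold mF
  rw [e1]
  have : tF z / ((z - x) * dslope hF x z) = (tF z / dslope hF x z) / (z - x) := by
    rw [div_div, mul_comm]
  rw [this]
  field_simp

lemma rectI_fm {f : ℂ → ℂ} (hf : Differentiable ℂ f) (n : ℕ) :
    rectI (fun z => f z * mF z) (rho n) =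
      2 * I * (lam * f 0 + ∑ ξ ∈ zS n, cc ξ * f ξ) := by
  have hp := pi_ne
  have hr := rho_pos n
  have key := rect_residue (g := fun z => f z * mF z) hr (insert 0 (zS n))
    (by
      intro ξ hξ
      rcases Finset.mem_insert.1 hξ with rfl | h
      · simpa using hr
      · exact (mem_zS.1 h).1)
    (fun ξ => if ξ = 0 then lam / π * f 0 else cc ξ / π * f ξ)
    (by
      intro z h1 h2 h3
      have hz0 : z ≠ 0 := by simpa using h3 0 (Finset.mem_insert_self _ _)
      have hhz : hF z ≠ 0 := by
        intro h
        have him := hF_real h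
        have hzr : z = (z.re : ℂ) := by
          apply Complex.ext <;> simp [him]
        by_cases hlt : |z.re| < rho n
        · exact h3 z.re (Finset.mem_insert_of_mem (mem_zS.2 ⟨hlt, by rw [← hzr]; exact h⟩)) hzr
        · exact hF_ne_sqB (n := n) (z := z) (Or.inl ⟨le_antisymm h1 (not_lt.1 hlt), h2⟩) h
      have a1 : ∀ᶠ w in 𝓝 z, w ≠ 0 := isOpen_ne.mem_nhds hz0
      have a2 : ∀ᶠ w in 𝓝 z, hF w ≠ 0 := hF_diff.continuous.continuousAt.eventually_ne hhz
      filter_upwards [a1, a2] with w w1 w2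
      exact (hf w).mul (mF_diffAt w1 w2))
    (by
      intro ξ hξ
      by_cases h0 : ξ = 0
      · subst h0; simp only [if_true]; exact res_zero hf
      · rw [if_neg h0]
        have := (Finset.mem_insert.1 hξ).resolve_left h0
        exact res_node hf (mem_zS.1 this).2)
  rw [key, Finset.sum_insert (zero_not_mem n), if_pos rfl]
  have : ∑ ξ ∈ zS n, (if ξ = 0 then lam / π * f 0 else cc ξ / π * f ξ) =
      ∑ ξ ∈ zS n, (cc ξ * f ξ) / π := by
    refine Finset.sum_congr rfl fun ξ hξ => ?_
    have hne : ξ ≠ 0 := by rintro rfl; exact zero_not_mem n hξ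
    rw [if_neg hne]; ring
  rw [this, ← Finset.sum_div]
  field_simp


lemma rect_gen {g : ℂ → ℂ} {a b c d : ℝ} (h : Differentiable ℂ g) :
    (∫ x in a..b, g (x + c * I)) - (∫ x in a..b, g (x + d * I)) +
      I * (∫ y in c..d, g (b + y * I)) - I * (∫ y in c..d, g (a + y * I)) = 0 := by
  have := Complex.integral_boundary_rect_eq_zero_of_differentiableOn g (a + c * I) (b + d * I)
    h.differentiableOn
  simpa using this

lemma fm_cont {f : ℂ → ℂ} (hf : Differentiable ℂ f) (n : ℕ) :
    ContinuousOn (fun z => f z * mF z) (sqB (rho n)) := by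
  intro z hz
  have h0 : z ≠ 0 := norm_pos_iff.1 (by linarith [sqB_norm_ge hz, rho_pos n])
  exact ((hf z).mul (mF_diffAt h0 (hF_ne_sqB hz))).continuousAt.continuousWithinAt

/-- one boundary piece -/
lemma piece {g k : ℝ → ℂ} {a b C : ℝ} (hab : a ≤ b) (s : ℂ)
    (hg : ContinuousOn g (Set.uIcc a b)) (hk : Continuous k)
    (hb : ∀ x ∈ Set.Icc a b, ‖g x + s * k x‖ ≤ C) :
    ∃ e : ℂ, ‖e‖ ≤ C * (b - a) ∧ (∫ x in a..b, g x) = e - s * ∫ x in a..b, k x := by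
  refine ⟨∫ x in a..b, (g x + s * k x), ?_, ?_⟩
  · have := intervalIntegral.norm_integral_le_of_norm_le_const (a := a) (b := b) (C := C)
      (f := fun x => g x + s * k x) (fun x hx => by
        rw [Set.uIoc_of_le hab] at hx
        exact hb x ⟨hx.1.le, hx.2⟩)
    rwa [abs_of_nonneg (by linarith)] at this
  · have hi : IntervalIntegrable (fun x => s * k x) volume a b :=
      (continuous_const.mul hk).intervalIntegrable _ _
    rw [intervalIntegral.integral_add hg.intervalIntegrable hi, intervalIntegral.integral_const_mul]
    ring

lemma quad {f : ℂ → ℂ} (hf : Differentiable ℂ f) {K : ℝ}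
    (hK : ∀ z : ℂ, 1 ≤ ‖z‖ → ‖f z‖ ≤ K * Real.exp (2 * π * |z.im|) / ‖z‖ ^ 2) (n : ℕ) :
    ‖(∫ x in (-rho n)..(rho n), f x * Wf x) - (lam * f 0 + ∑ ξ ∈ zS n, cc ξ * f ξ)‖
      ≤ 4 * K * bC / rho n := by
  set ρ := rho n with hρdef
  have hρ : 0 < ρ := rho_pos n
  have hρ1 : 3 / 2 ≤ ρ := rho_ge n
  have hbC := bC_pos
  have hK0 : 0 ≤ K := by
    have := hK 1 (by simp)
    simp at this
    exact (norm_nonneg _).trans this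
  have e1 : |ρ| = ρ := abs_of_pos hρ
  have e2 : |-ρ| = ρ := by rw [abs_neg, e1]
  have hkd : Differentiable ℂ fun z => f z * Wf z := hf.mul Wf_diff
  have hkc := hkd.continuous
  have hfc := fm_cont hf n
  have hfb : ∀ z ∈ sqB ρ, ‖f z‖ ≤ K * Real.exp (2 * π * |z.im|) / ρ ^ 2 := by
    intro z hz
    have h1 := sqB_norm_ge hz
    refine (hK z (by linarith)).trans ?_
    gcongr
  have bu : ∀ z ∈ sqB ρ, 0 ≤ z.im → ‖f z * mF z + I * (f z * Wf z)‖ ≤ K * bC / ρ ^ 2 := by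
    intro z hz hi
    have h1 := hfb z hz
    have h2 := mF_up_bound hz hi
    have e : f z * mF z + I * (f z * Wf z) = f z * (mF z + I * Wf z) := by ring
    rw [e, norm_mul]
    rw [abs_of_nonneg hi] at h1
    refine (mul_le_mul h1 h2 (norm_nonneg _) (by positivity)).trans (le_of_eq ?_)
    have : Real.exp (2 * π * z.im) * Real.exp (-(2 * π * z.im)) = 1 := by rw [← Real.exp_add]; simp
    linear_combination (K * bC / ρ ^ 2) * this
  have bd : ∀ z ∈ sqB ρ, z.im ≤ 0 → ‖f z * mF z + (-I) * (f z * Wf z)‖ ≤ K * bC / ρ ^ 2 := by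
    intro z hz hi
    have h1 := hfb z hz
    have h2 := mF_down_bound hz hi
    have e : f z * mF z + (-I) * (f z * Wf z) = f z * (mF z - I * Wf z) := by ring
    rw [e, norm_mul]
    rw [abs_of_nonpos hi] at h1
    refine (mul_le_mul h1 h2 (norm_nonneg _) (by positivity)).trans (le_of_eq ?_)
    have : Real.exp (2 * π * -z.im) * Real.exp (2 * π * z.im) = 1 := by rw [← Real.exp_add]; simp
    linear_combination (K * bC / ρ ^ 2) * this
  have icc : ∀ {x : ℝ}, x ∈ Set.Icc (-ρ) ρ → x ∈ Set.uIcc (-ρ) ρ := fun {x} hx => by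
    rwa [Set.uIcc_of_le (by linarith)]
  -- six pieces
  obtain ⟨eB, hB, qB⟩ := piece (a := -ρ) (b := ρ) (by linarith) (-I) (sqB_int_h hρ hfc e2)
    (k := fun x : ℝ => f (x + (-ρ : ℝ) * I) * Wf (x + (-ρ : ℝ) * I)) (hkc.comp (by fun_prop : Continuous fun x : ℝ => (x:ℂ) + (-ρ : ℝ) * I))
    (fun x hx => bd _ (mem_sqB_h hρ (icc hx) e2) (by simp; linarith))
  obtain ⟨eT, hT, qT⟩ := piece (a := -ρ) (b := ρ) (by linarith) I (sqB_int_h hρ hfc e1)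
    (k := fun x : ℝ => f (x + ρ * I) * Wf (x + ρ * I)) (hkc.comp (by fun_prop : Continuous fun x : ℝ => (x:ℂ) + ρ * I))
    (fun x hx => bu _ (mem_sqB_h hρ (icc hx) e1) (by simp; linarith))
  have su : Set.uIcc 0 ρ ⊆ Set.uIcc (-ρ) ρ := by
    rw [Set.uIcc_of_le hρ.le, Set.uIcc_of_le (by linarith)]; exact Set.Icc_subset_Icc_left (by linarith)
  have sd : Set.uIcc (-ρ) 0 ⊆ Set.uIcc (-ρ) ρ := by
    rw [Set.uIcc_of_le (by linarith), Set.uIcc_of_le (by linarith)]; exact Set.Icc_subset_Icc_right (by linarith)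
  have vert : ∀ x : ℝ, |x| = ρ → ∃ e : ℂ, ‖e‖ ≤ K * bC / ρ ^ 2 * (2 * ρ) ∧
      (∫ y in (-ρ)..ρ, f (x + y * I) * mF (x + y * I)) = e + I * (∫ y in (-ρ)..0, f (x + y * I) * Wf (x + y * I))
        - I * ∫ y in (0)..ρ, f (x + y * I) * Wf (x + y * I) := by
    intro x hx
    have hc : Continuous fun y : ℝ => (x:ℂ) + y * I := by fun_prop
    obtain ⟨e3, h3, q3⟩ := piece (a := -ρ) (b := 0) (by linarith) (-I) ((sqB_int_v hρ hfc hx).mono sd)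
      (k := fun y : ℝ => f (x + y * I) * Wf (x + y * I)) (hkc.comp hc)
      (fun y hy => bd _ (mem_sqB_v hρ hx (icc ⟨hy.1, by linarith [hy.2]⟩)) (by simpa using hy.2))
    obtain ⟨e4, h4, q4⟩ := piece (a := 0) (b := ρ) (by linarith) I ((sqB_int_v hρ hfc hx).mono su)
      (k := fun y : ℝ => f (x + y * I) * Wf (x + y * I)) (hkc.comp hc)
      (fun y hy => bu _ (mem_sqB_v hρ hx (icc ⟨by linarith [hy.1], hy.2⟩)) (by simpa using hy.1))
    refine ⟨e3 + e4, ?_, ?_⟩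
    · have := norm_add_le e3 e4
      linarith
    · rw [← intervalIntegral.integral_add_adjacent_intervals
        ((sqB_int_v hρ hfc hx).mono sd).intervalIntegrable ((sqB_int_v hρ hfc hx).mono su).intervalIntegrable,
        q3, q4]
      ring
  obtain ⟨eR, hR, qR⟩ := vert ρ e1
  obtain ⟨eL, hL, qL⟩ := vert (-ρ) e2
  have cu := rect_gen (a := -ρ) (b := ρ) (c := 0) (d := ρ) hkd
  have cd := rect_gen (a := -ρ) (b := ρ) (c := -ρ) (d := 0) hkd
  simp only [Complex.ofReal_zero, zero_mul, add_zero] at cu cd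
  have hfm := rectI_fm hf n
  unfold rectI at hfm
  rw [← hρdef, qB, qT, qR, qL] at hfm
  set H := ∫ x in (-ρ)..ρ, f x * Wf x
  have fin : 2 * I * (H - (lam * f 0 + ∑ ξ ∈ zS n, cc ξ * f ξ)) = -(eB - eT + I * eR - I * eL) := by
    linear_combination hfm + I * cu - I * cd
  have n1 : ‖2 * I * (H - (lam * f 0 + ∑ ξ ∈ zS n, cc ξ * f ξ))‖ =
      2 * ‖H - (lam * f 0 + ∑ ξ ∈ zS n, cc ξ * f ξ)‖ := by
    rw [norm_mul, norm_mul, Complex.norm_I]; simp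
  have n2 : ‖-(eB - eT + I * eR - I * eL)‖ ≤ ‖eB‖ + ‖eT‖ + ‖eR‖ + ‖eL‖ := by
    rw [norm_neg]
    refine (norm_sub_le _ _).trans ?_
    have a1 := norm_add_le (eB - eT) (I * eR)
    have a2 := norm_sub_le eB eT
    rw [norm_mul, Complex.norm_I, one_mul] at a1 ⊢
    linarith
  rw [fin] at n1
  have : K * bC / ρ ^ 2 * (2 * ρ) = 2 * K * bC / ρ := by field_simp
  have e3 : K * bC / ρ ^ 2 * (ρ - -ρ) = 2 * K * bC / ρ := by field_simp; ring
  rw [e3] at hB hT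
  rw [this] at hR hL
  have e4 : 4 * K * bC / ρ = 2 * (2 * K * bC / ρ) := by ring
  rw [e4]
  linarith


lemma pl_aux {H : ℂ → ℂ} (hH : Differentiable ℂ H) {τ B : ℝ} (hτ : 0 ≤ τ) (ht : HasExpTypeLE H τ)
    (hB : ∀ x : ℝ, ‖H x‖ ≤ B) (s : ℂ) (hs : s = 1 ∨ s = -1) (w : ℂ) (hw : 0 ≤ w.re) :
    ‖H (s * I * w)‖ ≤ B * Real.exp (τ * w.re) := by
  have ns : ‖s‖ = 1 := by rcases hs with rfl | rfl <;> simp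
  have key : ∀ ε > 0, ‖H (s * I * w)‖ ≤ B * Real.exp ((τ + ε) * w.re) := by
    intro ε hε
    obtain ⟨C, hC, hCb⟩ := ht ε hε
    have nrm : ∀ v : ℂ, ‖s * I * v‖ = ‖v‖ := fun v => by simp [ns]
    have ne : ∀ v : ℂ, ‖Complex.exp (-((τ + ε : ℝ) : ℂ) * v)‖ = Real.exp (-((τ + ε) * v.re)) := by
      intro v
      rw [Complex.norm_exp]
      congr 1
      rw [← Complex.ofReal_neg, Complex.re_ofReal_mul]; ring
    have := PhragmenLindelof.right_half_plane_of_bounded_on_real (z := w) (C := B)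
      (f := fun v => H (s * I * v) * Complex.exp (-((τ + ε : ℝ) : ℂ) * v)) ?_ ?_ ?_ ?_ hw
    · rw [norm_mul, ne, Real.exp_neg, ← div_eq_mul_inv, div_le_iff₀ (Real.exp_pos _)] at this
      exact this
    · apply Differentiable.diffContOnCl
      fun_prop
    · refine ⟨1, by norm_num, 2 * (τ + ε), ?_⟩
      refine Asymptotics.IsBigO.of_bound C (Eventually.of_forall fun v => ?_)
      rw [norm_mul, ne, Real.rpow_one, Real.norm_of_nonneg (Real.exp_pos _).le]
      have h1 := hCb (s * I * v)
      rw [nrm] at h1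
      have h2 : Real.exp (-((τ + ε) * v.re)) ≤ Real.exp ((τ + ε) * ‖v‖) := by
        apply Real.exp_le_exp.2
        have := (abs_le.1 (Complex.abs_re_le_norm v)).1
        nlinarith
      calc _ ≤ C * Real.exp ((τ + ε) * ‖v‖) * Real.exp ((τ + ε) * ‖v‖) := by gcongr
        _ = _ := by rw [mul_assoc, ← Real.exp_add]; ring_nf
    · refine ⟨C, ?_⟩
      rw [eventually_map]
      filter_upwards [eventually_ge_atTop 0] with x hx
      rw [norm_mul, ne]
      have h1 := hCb (s * I * x)
      rw [nrm, Complex.norm_real, Real.norm_of_nonneg hx] at h1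
      rw [Real.exp_neg, ← div_eq_mul_inv, div_le_iff₀ (Real.exp_pos _)]
      simpa using h1
    · intro x
      rw [norm_mul, ne]
      have e : s * I * (x * I) = ((-s.re * x : ℝ) : ℂ) := by
        have : s = (s.re : ℂ) := by rcases hs with rfl | rfl <;> simp
        have h2 : s * I * (x * I) = -(s * x) := by linear_combination (s * x) * Complex.I_mul_I
        rw [h2]; push_cast; rw [← this]; ring
      rw [e]
      simpa using hB (-s.re * x)
  have lim : Tendsto (fun ε : ℝ => B * Real.exp ((τ + ε) * w.re)) (𝓝[>] 0)
      (𝓝 (B * Real.exp ((τ + 0) * w.re))) := by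
    apply Tendsto.mono_left _ nhdsWithin_le_nhds
    apply Continuous.tendsto
    fun_prop
  rw [add_zero] at lim
  exact ge_of_tendsto lim (by filter_upwards [self_mem_nhdsWithin] with ε hε using key ε hε)

lemma pl_bound {H : ℂ → ℂ} (hH : Differentiable ℂ H) {τ B : ℝ} (hτ : 0 ≤ τ) (ht : HasExpTypeLE H τ)
    (hB : ∀ x : ℝ, ‖H x‖ ≤ B) (z : ℂ) : ‖H z‖ ≤ B * Real.exp (τ * |z.im|) := by
  rcases le_total 0 z.im with h | h
  · have := pl_aux hH hτ ht hB 1 (Or.inl rfl) (-I * z) (by simpa using h)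
    have e : (1 : ℂ) * I * (-I * z) = z := by linear_combination (-z) * Complex.I_mul_I
    rw [e] at this
    rw [abs_of_nonneg h]
    simpa using this
  · have := pl_aux hH hτ ht hB (-1) (Or.inr rfl) (I * z) (by simpa using h)
    have e : (-1 : ℂ) * I * (I * z) = z := by linear_combination (-z) * Complex.I_mul_I
    rw [e] at this
    rw [abs_of_nonpos h]
    simpa using this

lemma growth {F : ℂ → ℂ} (hF : Differentiable ℂ F) (ht : HasExpTypeLE F (2 * π))
    (hi : Integrable fun x : ℝ => F x) :
    ∃ K, 0 < K ∧ ∀ z : ℂ, ‖F z‖ ≤ K * Real.exp (2 * π * |z.im|) := by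
  obtain ⟨H, H0, hH⟩ := hF.isExactOn_univ.with_val_at 0 0
  have hH : ∀ z, HasDerivAt H (F z) z := fun z => hH z (Set.mem_univ _)
  have hHd : Differentiable ℂ H := fun z => (hH z).differentiableAt
  have tH : HasExpTypeLE H (2 * π) := by
    intro ε hε
    obtain ⟨C, hC, hb⟩ := ht (ε / 2) (by linarith)
    refine ⟨C * (2 / ε), by positivity, fun z => ?_⟩
    have := (convex_closedBall (0:ℂ) ‖z‖).norm_image_sub_le_of_norm_hasDerivWithin_le
      (f := H) (f' := F) (C := C * Real.exp ((2 * π + ε / 2) * ‖z‖)) (x := 0) (y := z)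
      (fun x _ => (hH x).hasDerivWithinAt) (fun x hx => by
        have hx' : ‖x‖ ≤ ‖z‖ := by simpa using hx
        refine (hb x).trans ?_
        gcongr) (by simp) (by simp)
    rw [H0, sub_zero, sub_zero] at this
    refine this.trans ?_
    have h1 : ‖z‖ ≤ 2 / ε * Real.exp (ε / 2 * ‖z‖) := by
      have := Real.add_one_le_exp (ε / 2 * ‖z‖)
      calc ‖z‖ = 2 / ε * (ε / 2 * ‖z‖) := by field_simp
        _ ≤ _ := by gcongr; linarith
    calc _ ≤ C * Real.exp ((2 * π + ε / 2) * ‖z‖) * (2 / ε * Real.exp (ε / 2 * ‖z‖)) := by gcongr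
      _ = C * (2 / ε) * (Real.exp ((2 * π + ε / 2) * ‖z‖) * Real.exp (ε / 2 * ‖z‖)) := by ring
      _ = _ := by rw [← Real.exp_add]; ring_nf
  set B := ∫ x : ℝ, ‖F x‖
  have hB0 : 0 ≤ B := integral_nonneg fun _ => norm_nonneg _
  have hB : ∀ x : ℝ, ‖H x‖ ≤ B := by
    intro x
    have : ∫ y in (0:ℝ)..x, F y = H x - H (0:ℝ) := by
      apply intervalIntegral.integral_eq_sub_of_hasDerivAt (f := fun y : ℝ => H y)
      · intro y _
        exact (hH y).comp_ofReal
      · exact hi.intervalIntegrable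
    rw [Complex.ofReal_zero, H0, sub_zero] at this
    rw [← this]
    refine (intervalIntegral.norm_integral_le_integral_norm_uIoc).trans ?_
    exact setIntegral_le_integral hi.norm (Eventually.of_forall fun _ => norm_nonneg _)
  have hp := pl_bound hHd (by positivity) tH hB
  refine ⟨(B + 1) * Real.exp (2 * π), by positivity, fun z => ?_⟩
  have := Complex.norm_deriv_le_of_forall_mem_sphere_norm_le (c := z) (R := 1) (f := H)
    (C := (B + 1) * Real.exp (2 * π) * Real.exp (2 * π * |z.im|)) one_pos hHd.diffContOnCl
    (fun w hw => by
      refine (hp w).trans ?_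
      have h1 : ‖w - z‖ = 1 := by simpa [dist_eq_norm] using hw
      have h2 : |w.im| ≤ |z.im| + 1 := by
        have h3 := Complex.abs_im_le_norm (w - z)
        rw [h1, Complex.sub_im] at h3
        have := abs_sub_abs_le_abs_sub w.im z.im
        linarith
      rw [mul_assoc (B + 1), ← Real.exp_add]
      have h4 : 2 * π * |w.im| ≤ 2 * π + 2 * π * |z.im| := by nlinarith [Real.pi_pos]
      gcongr
      linarith)
  rwa [(hH z).deriv, div_one] at this


lemma norm_sin_le (z : ℂ) : ‖Complex.sin z‖ ≤ Real.exp |z.im| := by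
  have h : 2 * ‖Complex.sin z‖ ≤ 2 * Real.exp |z.im| := by
    have e : 2 * ‖Complex.sin z‖ = ‖2 * Complex.sin z‖ := by simp
    rw [e, Complex.two_sin, norm_mul, Complex.norm_I, mul_one]
    refine (norm_sub_le _ _).trans ?_
    rw [Complex.norm_exp, Complex.norm_exp]
    have h1 : (-z * I).re ≤ |z.im| := by simpa using le_abs_self z.im
    have h2 : (z * I).re ≤ |z.im| := by simpa using neg_le_abs z.im
    have := Real.exp_le_exp.2 h1
    have := Real.exp_le_exp.2 h2
    linarith
  linarith

lemma norm_cos_le (z : ℂ) : ‖Complex.cos z‖ ≤ Real.exp |z.im| := by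
  have h : 2 * ‖Complex.cos z‖ ≤ 2 * Real.exp |z.im| := by
    have e : 2 * ‖Complex.cos z‖ = ‖2 * Complex.cos z‖ := by simp
    rw [e, Complex.two_cos]
    refine (norm_add_le _ _).trans ?_
    rw [Complex.norm_exp, Complex.norm_exp]
    have h1 : (-z * I).re ≤ |z.im| := by simpa using le_abs_self z.im
    have h2 : (z * I).re ≤ |z.im| := by simpa using neg_le_abs z.im
    have := Real.exp_le_exp.2 h1
    have := Real.exp_le_exp.2 h2
    linarith
  linarith

lemma sC_ofReal (x : ℝ) : sC x = (Real.sinc x : ℂ) := by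
  by_cases h : x = 0
  · simp [h, sC_zero]
  · rw [sC_ne (by exact_mod_cast h), Real.sinc_of_ne_zero h]; push_cast; rfl

noncomputable def WR (x : ℝ) : ℝ := 1 - Real.sinc (π * x) ^ 2

lemma Wf_ofReal (x : ℝ) : Wf x = (WR x : ℂ) := by
  unfold Wf WR
  rw [← Complex.ofReal_mul, sC_ofReal]; push_cast; rfl

lemma sinc_sq_le (x : ℝ) : Real.sinc x ^ 2 ≤ 1 := by
  have h1 := Real.sinc_le_one x
  have h2 := Real.neg_one_le_sinc x
  nlinarith

lemma WR_nonneg (x : ℝ) : 0 ≤ WR x := by have := sinc_sq_le (π * x); unfold WR; linarith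
lemma WR_le (x : ℝ) : WR x ≤ 1 := by unfold WR; nlinarith [sq_nonneg (Real.sinc (π * x))]
lemma WR_cont : Continuous WR := by
  unfold WR
  exact continuous_const.sub ((Real.continuous_sinc.comp (by fun_prop)).pow 2)

lemma WR_pair {x : ℝ} (hx : x ≠ 0) : pairCorKernel x = WR x := by
  unfold pairCorKernel WR
  rw [Real.sinc_of_ne_zero (mul_ne_zero Real.pi_ne_zero hx)]

lemma Mpc_eq (R : ℝ → ℝ) : Mpc R = ∫ x, R x * WR x := by
  unfold Mpc
  apply integral_congr_ae
  filter_upwards [Measure.ae_ne volume (0:ℝ)] with x hx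
  rw [WR_pair hx]

lemma WR_integrable {R : ℝ → ℝ} (hR : Integrable R) {c : ℝ} : Integrable fun x => R x * WR (c * x) :=
  hR.mul_bdd (c := 1) (WR_cont.comp (by fun_prop : Continuous fun x : ℝ => c * x)).aestronglyMeasurable
    (Eventually.of_forall fun x => by
      show ‖WR (c * x)‖ ≤ 1
      rw [Real.norm_of_nonneg (WR_nonneg _)]; exact WR_le _)

lemma rho_tendsto : Tendsto rho atTop atTop := by
  unfold rho
  exact tendsto_atTop_add_const_right _ _ (tendsto_atTop_add_const_right _ _ tendsto_natCast_atTop_atTop)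

lemma ineq_a {R : ℝ → ℝ} (hR : Integrable R) (hnn : ∀ x, 0 ≤ R x) {F : ℂ → ℂ}
    (hF' : Differentiable ℂ F) (hFR : ∀ x : ℝ, F x = (R x : ℂ)) {K : ℝ} (hK0 : 0 < K)
    (hK : ∀ z : ℂ, ‖F z‖ ≤ K * Real.exp (2 * π * |z.im|)) {a : ℝ} (ha : 0 < a) (ha1 : a < 1)
    {ξ : ℝ} (hξ : hF ξ = 0) :
    lam * R 0 + cc ξ * (R (a * ξ) * Real.sinc (π * (1 - a) * ξ) ^ 2)
      ≤ a⁻¹ * ∫ u, R u * WR (a⁻¹ * u) := by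
  have hpi := Real.pi_pos
  have hd : 0 < 1 - a := by linarith
  set f : ℂ → ℂ := fun z => F (a * z) * sC (((π * (1 - a) : ℝ) : ℂ) * z) ^ 2 with hfdef
  have hf : Differentiable ℂ f :=
    (hF'.comp (by fun_prop : Differentiable ℂ fun z : ℂ => (a:ℂ) * z)).mul
      ((sC_diff.comp (by fun_prop : Differentiable ℂ fun z : ℂ => ((π * (1 - a) : ℝ) : ℂ) * z)).pow 2)
  set g : ℝ → ℝ := fun x => R (a * x) * Real.sinc (π * (1 - a) * x) ^ 2 with hgdef
  have hfg : ∀ x : ℝ, f x = (g x : ℂ) := by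
    intro x
    simp only [hfdef, hgdef]
    rw [← Complex.ofReal_mul, hFR, ← Complex.ofReal_mul, sC_ofReal]
    push_cast; rfl
  have hg0 : ∀ x, 0 ≤ g x := fun x => mul_nonneg (hnn _) (sq_nonneg _)
  set K' := K / (π * (1 - a)) ^ 2 with hK'
  have hfb : ∀ z : ℂ, 1 ≤ ‖z‖ → ‖f z‖ ≤ K' * Real.exp (2 * π * |z.im|) / ‖z‖ ^ 2 := by
    intro z hz
    have hz0 : z ≠ 0 := norm_pos_iff.1 (by linarith)
    have hw0 : ((π * (1 - a) : ℝ) : ℂ) * z ≠ 0 :=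
      mul_ne_zero (by exact_mod_cast (mul_pos hpi hd).ne') hz0
    have h1 := hK (a * z)
    have h2 := norm_sin_le (((π * (1 - a) : ℝ) : ℂ) * z)
    rw [Complex.im_ofReal_mul, abs_mul, abs_of_pos ha] at h1
    rw [Complex.im_ofReal_mul, abs_mul, abs_of_pos (mul_pos hpi hd)] at h2
    simp only [hfdef]
    rw [norm_mul, norm_pow, sC_ne hw0, norm_div, norm_mul, Complex.norm_real,
      Real.norm_of_nonneg (mul_pos hpi hd).le, div_pow, mul_pow]
    have h3 : ‖Complex.sin (((π * (1 - a) : ℝ) : ℂ) * z)‖ ^ 2 ≤ Real.exp (π * (1 - a) * |z.im|) ^ 2 := by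
      gcongr
    have h4 : Real.exp (2 * π * (a * |z.im|)) * Real.exp (π * (1 - a) * |z.im|) ^ 2
        = Real.exp (2 * π * |z.im|) := by
      rw [← Real.exp_nat_mul, ← Real.exp_add]; congr 1; push_cast; ring
    rw [← h4, hK']
    calc _ ≤ (K * Real.exp (2 * π * (a * |z.im|))) * (Real.exp (π * (1 - a) * |z.im|) ^ 2 /
          ((π * (1 - a)) ^ 2 * ‖z‖ ^ 2)) := by gcongr
      _ = _ := by
        have : ‖z‖ ≠ 0 := by linarith
        field_simp
  have hI : Integrable fun x => R (a * x) * WR x := by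
    have := (WR_integrable hR (c := a⁻¹)).comp_mul_left' ha.ne'
    refine this.congr (Eventually.of_forall fun x => ?_)
    simp [inv_mul_cancel_left₀ ha.ne']
  have hgc : Continuous g := by
    have : g = fun x : ℝ => (f x).re := by
      funext x; rw [hfg]; simp
    rw [this]
    exact Complex.continuous_re.comp (hf.continuous.comp Complex.continuous_ofReal)
  have hchange : ∫ x, R (a * x) * WR x = a⁻¹ * ∫ u, R u * WR (a⁻¹ * u) := by
    have := Measure.integral_comp_mul_left (fun u => R u * WR (a⁻¹ * u)) a
    simp only [inv_mul_cancel_left₀ ha.ne'] at this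
    rw [this, abs_of_pos (inv_pos.2 ha), smul_eq_mul]
  rw [← hchange]
  have main : ∀ᶠ n in atTop, lam * R 0 + cc ξ * g ξ ≤ (∫ x, R (a * x) * WR x) + 4 * K' * bC / rho n := by
    filter_upwards [rho_tendsto.eventually_gt_atTop |ξ|] with n hn
    have q := quad hf hfb n
    have e : (∫ x in (-rho n)..(rho n), f x * Wf x) - (lam * f 0 + ∑ ξ ∈ zS n, cc ξ * f ξ)
        = (((∫ x in (-rho n)..(rho n), g x * WR x) - (lam * g 0 + ∑ ξ ∈ zS n, cc ξ * g ξ) : ℝ) : ℂ) := by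
      have e0 := hfg 0
      rw [Complex.ofReal_zero] at e0
      simp only [hfg, Wf_ofReal, e0]
      push_cast
      rw [← intervalIntegral.integral_ofReal]
      push_cast
      rfl
    rw [e, Complex.norm_real, Real.norm_eq_abs] at q
    have q1 := (abs_le.1 q).1
    have g0 : g 0 = R 0 := by simp [hgdef]
    rw [g0] at q1
    have s1 : cc ξ * g ξ ≤ ∑ ξ ∈ zS n, cc ξ * g ξ :=
      Finset.single_le_sum (f := fun ξ => cc ξ * g ξ)
        (fun x hx => mul_nonneg (cc_nonneg (mem_zS.1 hx).2) (hg0 x)) (mem_zS.2 ⟨hn, hξ⟩)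
    have s2 : (∫ x in (-rho n)..(rho n), g x * WR x) ≤ ∫ x, R (a * x) * WR x := by
      have hr := rho_pos n
      calc _ ≤ ∫ x in (-rho n)..(rho n), R (a * x) * WR x := by
            apply intervalIntegral.integral_mono_on (by linarith)
              ((hgc.mul WR_cont).intervalIntegrable _ _) hI.intervalIntegrable
            intro x _
            have := sinc_sq_le (π * (1 - a) * x)
            have h1 := WR_nonneg x
            have h2 := hnn (a * x)
            simp only [hgdef]
            apply mul_le_mul_of_nonneg_right _ h1
            nlinarith
        _ ≤ _ := by
            rw [intervalIntegral.integral_of_le (by linarith)]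
            exact setIntegral_le_integral hI (Eventually.of_forall fun x => mul_nonneg (hnn _) (WR_nonneg _))
    linarith
  have lim : Tendsto (fun n => (∫ x, R (a * x) * WR x) + 4 * K' * bC / rho n) atTop
      (𝓝 ((∫ x, R (a * x) * WR x) + 0)) :=
    tendsto_const_nhds.add (rho_tendsto.const_div_atTop _)
  rw [add_zero] at lim
  exact ge_of_tendsto lim main

lemma ineq_main {R : ℝ → ℝ} (hR : Integrable R) (hnn : ∀ x, 0 ≤ R x) {F : ℂ → ℂ}
    (hF' : Differentiable ℂ F) (hFR : ∀ x : ℝ, F x = (R x : ℂ)) {K : ℝ} (hK0 : 0 < K)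
    (hK : ∀ z : ℂ, ‖F z‖ ≤ K * Real.exp (2 * π * |z.im|)) {ξ : ℝ} (hξ : hF ξ = 0) :
    lam * R 0 + cc ξ * R ξ ≤ Mpc R := by
  rw [Mpc_eq]
  have hRc : Continuous R := by
    have : R = fun x : ℝ => (F x).re := by funext x; rw [hFR]; simp
    rw [this]
    exact Complex.continuous_re.comp (hF'.continuous.comp Complex.continuous_ofReal)
  have l1 : Tendsto (fun a : ℝ => lam * R 0 + cc ξ * (R (a * ξ) * Real.sinc (π * (1 - a) * ξ) ^ 2))
      (𝓝[<] 1) (𝓝 (lam * R 0 + cc ξ * R ξ)) := by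
    apply Tendsto.mono_left _ nhdsWithin_le_nhds
    have c : Continuous fun a : ℝ => lam * R 0 + cc ξ * (R (a * ξ) * Real.sinc (π * (1 - a) * ξ) ^ 2) := by
      have c1 : Continuous fun a : ℝ => R (a * ξ) := hRc.comp (by fun_prop)
      have c2 : Continuous fun a : ℝ => Real.sinc (π * (1 - a) * ξ) := Real.continuous_sinc.comp (by fun_prop)
      fun_prop
    exact c.tendsto' _ _ (by simp)
  have l2 : Tendsto (fun a : ℝ => a⁻¹ * ∫ u, R u * WR (a⁻¹ * u)) (𝓝[<] 1) (𝓝 (∫ u, R u * WR u)) := by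
    apply Tendsto.mono_left _ nhdsWithin_le_nhds
    have c : ContinuousAt (fun a : ℝ => ∫ u, R u * WR (a⁻¹ * u)) 1 := by
      apply continuousAt_of_dominated (bound := fun u => R u)
      · exact Eventually.of_forall fun a => (WR_integrable hR).aestronglyMeasurable
      · refine Eventually.of_forall fun a => Eventually.of_forall fun u => ?_
        rw [Real.norm_of_nonneg (mul_nonneg (hnn _) (WR_nonneg _))]
        exact mul_le_of_le_one_right (hnn u) (WR_le _)
      · exact hR
      · refine Eventually.of_forall fun u => ?_
        refine continuousAt_const.mul (WR_cont.continuousAt.comp ?_)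
        exact (continuousAt_inv₀ one_ne_zero).mul continuousAt_const
    have c2 : ContinuousAt (fun a : ℝ => a⁻¹ * ∫ u, R u * WR (a⁻¹ * u)) 1 :=
      (continuousAt_inv₀ one_ne_zero).mul c
    simpa [ContinuousAt] using c2
  refine le_of_tendsto_of_tendsto l1 l2 ?_
  filter_upwards [Ioo_mem_nhdsLT (show (0:ℝ) < 1 by norm_num)] with a ha
  exact ineq_a hR hnn hF' hFR hK0 hK ha.1 ha.2 hξ

lemma ineq_basic {R : ℝ → ℝ} (hR : Integrable R) (hnn : ∀ x, 0 ≤ R x) {F : ℂ → ℂ}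
    (hF' : Differentiable ℂ F) (hFR : ∀ x : ℝ, F x = (R x : ℂ)) {K : ℝ} (hK0 : 0 < K)
    (hK : ∀ z : ℂ, ‖F z‖ ≤ K * Real.exp (2 * π * |z.im|)) : lam * R 0 ≤ Mpc R := by
  have := ineq_main hR hnn hF' hFR hK0 hK zero_al
  have h2 := mul_nonneg (cc_nonneg zero_al) (hnn (invSqrt2 / π))
  linarith


noncomputable def pF (z : ℂ) : ℂ := 1 - 2 * (π : ℂ) ^ 2 * z ^ 2
lemma pF_diff : Differentiable ℂ pF := by unfold pF; fun_prop
lemma pF_zero : pF 0 = 1 := by simp [pF]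

lemma pF_ofReal (x : ℝ) : pF x = ((1 - 2 * π ^ 2 * x ^ 2 : ℝ) : ℂ) := by unfold pF; push_cast; rfl

lemma pF_ge {z : ℂ} (hz : 1 ≤ ‖z‖) : ‖z‖ ^ 2 ≤ ‖pF z‖ := by
  have h1 : ‖2 * (π : ℂ) ^ 2 * z ^ 2‖ = 2 * π ^ 2 * ‖z‖ ^ 2 := by
    simp [abs_of_pos Real.pi_pos]
  have h2 := norm_sub_norm_le (2 * (π : ℂ) ^ 2 * z ^ 2) 1
  rw [h1, norm_one, norm_sub_rev] at h2
  have : ‖pF z‖ = ‖1 - 2 * (π : ℂ) ^ 2 * z ^ 2‖ := rfl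
  rw [this]
  have := Real.pi_gt_three
  have h3 : 9 ≤ π ^ 2 := by nlinarith
  nlinarith

lemma pF_le {z : ℂ} (hz : 1 ≤ ‖z‖) : ‖pF z‖ ≤ (1 + 2 * π ^ 2) * ‖z‖ ^ 2 := by
  have h1 : ‖2 * (π : ℂ) ^ 2 * z ^ 2‖ = 2 * π ^ 2 * ‖z‖ ^ 2 := by
    simp [abs_of_pos Real.pi_pos]
  have h2 := norm_sub_le 1 (2 * (π : ℂ) ^ 2 * z ^ 2)
  rw [h1, norm_one] at h2
  have : ‖pF z‖ = ‖1 - 2 * (π : ℂ) ^ 2 * z ^ 2‖ := rfl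
  rw [this]
  nlinarith

lemma hF_le {z : ℂ} (hz : 1 ≤ ‖z‖) : ‖hF z‖ ≤ (1 + kap) * ‖z‖ * Real.exp (π * |z.im|) := by
  have hk := kap_pos
  have h1 := norm_cos_le (π * z)
  have h2 := norm_sin_le (π * z)
  rw [Complex.im_ofReal_mul, abs_mul, abs_of_pos Real.pi_pos] at h1 h2
  unfold hF
  refine (norm_sub_le _ _).trans ?_
  rw [norm_mul, norm_mul, Complex.norm_real, Real.norm_of_nonneg hk.le]
  have h3 : kap * ‖z‖ * ‖Complex.sin (π * z)‖ ≤ kap * ‖z‖ * Real.exp (π * |z.im|) := by gcongr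
  have := Real.exp_pos (π * |z.im|)
  nlinarith

lemma eq_back {R : ℝ → ℝ} (hR : Integrable R) {F : ℂ → ℂ} (hF' : Differentiable ℂ F)
    (hform : ∀ z, pF z ≠ 0 → F z = (pF z ^ 2)⁻¹ * hF z ^ 2) (hFR : ∀ x : ℝ, (R x : ℂ) = F x) :
    Mpc R = lam := by
  have hk := kap_pos
  have hb : ∀ z : ℂ, 1 ≤ ‖z‖ → ‖F z‖ ≤ (1 + kap) ^ 2 * Real.exp (2 * π * |z.im|) / ‖z‖ ^ 2 := by
    intro z hz
    have hz0 : 0 < ‖z‖ := by linarith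
    have h1 := pF_ge hz
    have h2 := hF_le hz
    have hp : 0 < ‖pF z‖ := lt_of_lt_of_le (by positivity) h1
    rw [hform z (norm_pos_iff.1 hp), norm_mul, norm_inv, norm_pow, norm_pow]
    calc _ ≤ ((‖z‖ ^ 2) ^ 2)⁻¹ * ((1 + kap) * ‖z‖ * Real.exp (π * |z.im|)) ^ 2 := by gcongr
      _ = (1 + kap) ^ 2 * (Real.exp (π * |z.im|)) ^ 2 / ‖z‖ ^ 2 := by field_simp
      _ = _ := by rw [← Real.exp_nat_mul]; push_cast; ring_nf
  have F0 : F 0 = 1 := by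
    rw [hform 0 (by rw [pF_zero]; exact one_ne_zero), pF_zero, hF_zero]; simp
  have hs : ∀ n, ∑ ξ ∈ zS n, (cc ξ : ℂ) * F ξ = 0 := by
    intro n
    apply Finset.sum_eq_zero
    intro ξ hξ
    by_cases h : 2 * π ^ 2 * ξ ^ 2 = 1
    · rw [cc_zero h]; simp
    · rw [hform ξ, (mem_zS.1 hξ).2]
      · simp
      · rw [pF_ofReal, Complex.ofReal_ne_zero]
        intro h'; apply h; linarith
  have q : ∀ n, ‖((∫ x in (-rho n)..(rho n), R x * WR x : ℝ) : ℂ) - lam‖ ≤ 4 * (1 + kap) ^ 2 * bC / rho n := by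
    intro n
    have q := quad hF' hb n
    rw [hs, F0, add_zero, mul_one] at q
    simp only [← hFR, Wf_ofReal] at q
    rw [← intervalIntegral.integral_ofReal]
    push_cast
    exact q
  have l1 : Tendsto (fun n => ∫ x in (-rho n)..(rho n), R x * WR x) atTop (𝓝 (∫ x, R x * WR x)) := by
    have hi := WR_integrable hR (c := 1)
    simp only [one_mul] at hi
    exact intervalIntegral_tendsto_integral hi (tendsto_neg_atTop_atBot.comp rho_tendsto) rho_tendsto
  have l2 : Tendsto (fun n => ∫ x in (-rho n)..(rho n), R x * WR x) atTop (𝓝 lam) := by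
    rw [tendsto_iff_norm_sub_tendsto_zero]
    refine squeeze_zero (fun _ => norm_nonneg _) (fun n => ?_) (rho_tendsto.const_div_atTop (4 * (1 + kap) ^ 2 * bC))
    have := q n
    rwa [← Complex.ofReal_sub, Complex.norm_real] at this
  rw [Mpc_eq]
  exact tendsto_nhds_unique l1 l2


lemma deriv_zero_of_min {R : ℝ → ℝ} (hnn : ∀ x, 0 ≤ R x) {F : ℂ → ℂ}
    (hF' : Differentiable ℂ F) (hFR : ∀ x : ℝ, F x = (R x : ℂ)) {ξ : ℝ} (h : R ξ = 0) :
    deriv F ξ = 0 := by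
  have h1 : HasDerivAt F (deriv F ξ) (ξ : ℂ) := (hF' ξ).hasDerivAt
  have h2 : HasDerivAt R (deriv F ξ).re ξ := by
    have := h1.real_of_complex
    simpa [hFR] using this
  have h3 : (deriv F ξ).re = 0 := by
    refine IsLocalMin.hasDerivAt_eq_zero ?_ h2
    exact Eventually.of_forall fun x => by rw [h]; exact hnn x
  have h4 := h2.ofReal_comp
  have h5 : HasDerivAt (fun y : ℝ => F y) (deriv F ξ) ξ := h1.comp_ofReal
  simp only [hFR] at h5
  rw [h5.unique h4, h3]; simp

lemma quot_entire {A : ℂ → ℂ} (hA : Differentiable ℂ A) (hz : ∀ ξ : ℝ, hF ξ = 0 → A ξ = 0 ∧ deriv A ξ = 0) :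
    ∃ ψ : ℂ → ℂ, Differentiable ℂ ψ ∧ ∀ z, ψ z * hF z ^ 2 = A z := by
  have hzero : ∀ c : ℂ, hF c = 0 → ∃ ξ : ℝ, c = ξ := fun c hc =>
    ⟨c.re, Complex.ext (by simp) (by simp [hF_real hc])⟩
  have hda : ∀ z, hF z ≠ 0 → DifferentiableAt ℂ (fun z => A z / hF z ^ 2) z := fun z h =>
    (hA z).div ((hF_diff z).pow 2) (pow_ne_zero 2 h)
  refine ⟨remExt fun z => A z / hF z ^ 2, fun c => ?_, fun z => ?_⟩
  · by_cases hc : hF c = 0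
    · obtain ⟨ξ, rfl⟩ := hzero c hc
      have hd := (zero_deriv hc).1
      have hne : ∀ᶠ z in 𝓝[≠] (ξ : ℂ), hF z ≠ 0 := by
        have := (hF_hasDeriv (ξ:ℂ)).eventually_ne (c := 0) hd
        exact this
      apply remExt_diff
      · filter_upwards [hne] with z h using hda z h
      · have hlim : Tendsto (fun z => dslope A ξ z / dslope hF ξ z ^ 2) (𝓝[≠] (ξ:ℂ)) (𝓝 0) := by
          have hd' : dslope hF ξ ξ ≠ 0 := by rw [dslope_same, (hF_hasDeriv (ξ:ℂ)).deriv]; exact hd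
          have : ContinuousAt (fun z => dslope A ξ z / dslope hF ξ z ^ 2) (ξ:ℂ) :=
            ((entire_dslope hA ξ) ξ).continuousAt.div (((entire_dslope hF_diff ξ) ξ).continuousAt.pow 2)
              (pow_ne_zero 2 hd')
          have h2 := this.tendsto
          simp only [dslope_same, (hz ξ hc).2, zero_div] at h2
          exact h2.mono_left nhdsWithin_le_nhds
        refine hlim.congr' ?_
        filter_upwards [self_mem_nhdsWithin, hne] with z hz1 hz2
        have hz1 : z - ξ ≠ 0 := sub_ne_zero.2 hz1
        have e1 := sub_smul_dslope A ξ z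
        have e2 := sub_smul_dslope hF ξ z
        rw [(hz ξ hc).1, sub_zero, smul_eq_mul] at e1
        rw [hc, sub_zero, smul_eq_mul] at e2
        have hd2 : dslope hF ξ z ≠ 0 := by
          intro h; rw [h, mul_zero] at e2; exact hz2 e2.symm
        rw [← e1, ← e2]
        field_simp
    · apply remExt_diff
      · exact (hF_diff.continuous.continuousAt.eventually_ne hc |>.mono hda).filter_mono nhdsWithin_le_nhds
      · have : ContinuousAt (fun z => (z - c) * (A z / hF z ^ 2)) c :=
          (continuousAt_id.sub continuousAt_const).mul (hda c hc).continuousAt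
        have h2 := this.tendsto
        simp only [sub_self, zero_mul] at h2
        exact h2.mono_left nhdsWithin_le_nhds
  · by_cases hc : hF z = 0
    · obtain ⟨ξ, rfl⟩ := hzero z hc
      rw [hc, (hz ξ hc).1]; simp
    · rw [remExt_eq (hda z hc).continuousAt]
      exact div_mul_cancel₀ _ (pow_ne_zero 2 hc)

lemma maxmod {f : ℂ → ℂ} (hf : Differentiable ℂ f) {C : ℝ} (hC : ∀ n, ∀ z ∈ sqB (rho n), ‖f z‖ ≤ C)
    (z : ℂ) : ‖f z‖ ≤ C := by
  obtain ⟨n, hn⟩ := (rho_tendsto.eventually_gt_atTop ‖z‖).exists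
  have hr := rho_pos n
  have hre := Complex.abs_re_le_norm z
  have him := Complex.abs_im_le_norm z
  refine Complex.norm_le_of_forall_mem_frontier_norm_le
    (U := Set.Ioo (-rho n) (rho n) ×ℂ Set.Ioo (-rho n) (rho n)) ?_ hf.diffContOnCl ?_ (subset_closure ?_)
  · exact (Metric.isBounded_Ioo _ _).reProdIm (Metric.isBounded_Ioo _ _)
  · intro w hw
    refine hC n w ?_
    rw [Complex.frontier_reProdIm, closure_Ioo (by linarith), frontier_Ioo (by linarith)] at hw
    have aux : ∀ y : ℝ, y ∈ ({-rho n, rho n} : Set ℝ) → |y| = rho n := by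
      rintro y (rfl | rfl)
      · rw [abs_neg, abs_of_pos hr]
      · rw [abs_of_pos hr]
    unfold sqB
    rcases hw with h | h
    · exact Or.inr ⟨aux _ h.2, abs_le.2 h.1⟩
    · exact Or.inl ⟨aux _ h.1, abs_le.2 h.2⟩
  · exact ⟨abs_lt.1 (by linarith), abs_lt.1 (by linarith)⟩

lemma quad_poly {ψ : ℂ → ℂ} (hψ : Differentiable ℂ ψ) {C : ℝ}
    (hC : ∀ n, ∀ z ∈ sqB (rho n), ‖ψ z‖ ≤ C * ‖z‖ ^ 2) : ∃ b c : ℂ, ∀ z, ψ z = ψ 0 + b * z + c * z ^ 2 := by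
  set D1 := dslope ψ 0
  set D2 := dslope D1 0
  have hD1 : Differentiable ℂ D1 := entire_dslope hψ 0
  have hD2 : Differentiable ℂ D2 := entire_dslope hD1 0
  have e1 : ∀ z, ψ z = ψ 0 + z * D1 z := by
    intro z
    have := sub_smul_dslope ψ 0 z
    rw [sub_zero, smul_eq_mul] at this
    linear_combination -this
  have e2 : ∀ z, D1 z = D1 0 + z * D2 z := by
    intro z
    have := sub_smul_dslope D1 0 z
    rw [sub_zero, smul_eq_mul] at this
    linear_combination -this
  have e3 : ∀ z, ψ z = ψ 0 + D1 0 * z + D2 z * z ^ 2 := by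
    intro z; rw [e1, e2]; ring
  have hb : ∀ z, ‖D2 z‖ ≤ C + ‖ψ 0‖ + ‖D1 0‖ := by
    apply maxmod hD2
    intro n z hz
    have h1 : 1 ≤ ‖z‖ := by linarith [sqB_norm_ge hz, rho_ge n]
    have h2 := hC n z hz
    have h3 : ‖D2 z‖ * ‖z‖ ^ 2 ≤ ‖ψ z‖ + ‖ψ 0‖ + ‖D1 0‖ * ‖z‖ := by
      have : D2 z * z ^ 2 = ψ z - ψ 0 - D1 0 * z := by rw [e3 z]; ring
      rw [← norm_pow, ← norm_mul, this]
      have a1 := norm_sub_le (ψ z - ψ 0) (D1 0 * z)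
      have a2 := norm_sub_le (ψ z) (ψ 0)
      rw [norm_mul] at a1
      linarith
    have hz2 : 0 < ‖z‖ ^ 2 := by positivity
    refine le_of_mul_le_mul_right (a := ‖z‖ ^ 2) ?_ hz2
    have h4 : ‖ψ 0‖ ≤ ‖ψ 0‖ * ‖z‖ ^ 2 := le_mul_of_one_le_right (norm_nonneg _) (one_le_pow₀ h1)
    have h5 : ‖D1 0‖ * ‖z‖ ≤ ‖D1 0‖ * ‖z‖ ^ 2 := by
      apply mul_le_mul_of_nonneg_left _ (norm_nonneg _)
      nlinarith
    linarith
  refine ⟨D1 0, D2 0, fun z => ?_⟩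
  have hbd : Bornology.IsBounded (Set.range D2) := by
    rw [isBounded_iff_forall_norm_le]
    exact ⟨_, by rintro _ ⟨w, rfl⟩; exact hb w⟩
  rw [e3, hD2.apply_eq_apply_of_bounded hbd z 0]


noncomputable def hr (x : ℝ) : ℝ := Real.cos (π * x) - kap * x * Real.sin (π * x)

lemma hr_int (n : ℤ) : hr n ^ 2 = 1 := by
  unfold hr
  have h1 : Real.sin (π * n) = 0 := by rw [mul_comm]; exact Real.sin_int_mul_pi n
  have h2 := Real.sin_sq_add_cos_sq (π * n)
  rw [h1] at h2 ⊢
  simpa using h2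

/-- the quadratic coefficient must vanish -/
lemma no_quad {Q : ℝ → ℝ} (hQ : Integrable Q) {c : ℝ} (hc : 0 < c)
    (h : ∀ x, Q x * (1 - 2 * π ^ 2 * x ^ 2) ^ 2 = (2 + 2 * c * x ^ 2) * hr x ^ 2) : False := by
  have hk := kap_pos
  have hp := Real.pi_pos
  set P := (1 + 2 * π ^ 2) ^ 2 with hP
  have hP0 : 0 < P := by positivity
  have b1 : ∀ x, 1 ≤ x → 2 * c * hr x ^ 2 ≤ P * x ^ 2 * Q x := by
    intro x hx
    have hx2 : 1 ≤ x ^ 2 := one_le_pow₀ hx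
    have hp9 : 9 ≤ π ^ 2 := by nlinarith [Real.pi_gt_three]
    have hpos : 0 < (1 - 2 * π ^ 2 * x ^ 2) ^ 2 := by
      have : 1 - 2 * π ^ 2 * x ^ 2 < 0 := by nlinarith
      exact sq_pos_of_neg this
    have hQ0 : 0 ≤ Q x := by
      have : 0 ≤ Q x * (1 - 2 * π ^ 2 * x ^ 2) ^ 2 := by rw [h x]; positivity
      exact nonneg_of_mul_nonneg_left this hpos
    have h1 : (1 - 2 * π ^ 2 * x ^ 2) ^ 2 ≤ P * x ^ 4 := by
      have : P * x ^ 4 = ((1 + 2 * π ^ 2) * x ^ 2) ^ 2 := by rw [hP]; ring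
      rw [this]
      apply sq_le_sq'
      · nlinarith
      · nlinarith
    have h2 : (2 + 2 * c * x ^ 2) * hr x ^ 2 ≤ Q x * (P * x ^ 4) := by
      rw [← h x]; gcongr
    have h3 : x ^ 2 * (2 * c * hr x ^ 2) ≤ x ^ 2 * (P * x ^ 2 * Q x) := by
      nlinarith [sq_nonneg (hr x)]
    exact le_of_mul_le_mul_left h3 (by linarith)
  have b2 : ∀ x, 1 ≤ x → Real.sin (π * x) ^ 2 ≤ 2 / kap ^ 2 * (P / (2 * c) * Q x + 2 * (1 + x ^ 2)⁻¹) := by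
    intro x hx
    have hx2 : 1 ≤ x ^ 2 := one_le_pow₀ hx
    have h1 := b1 x hx
    have h2 : kap ^ 2 * x ^ 2 * Real.sin (π * x) ^ 2 ≤ 2 * hr x ^ 2 + 2 := by
      unfold hr
      have := Real.cos_sq_le_one (π * x)
      nlinarith [sq_nonneg (kap * x * Real.sin (π * x) - 2 * Real.cos (π * x))]
    have h3 : hr x ^ 2 ≤ x ^ 2 * (P / (2 * c) * Q x) := by
      have : x ^ 2 * (P / (2 * c) * Q x) = (P * x ^ 2 * Q x) / (2 * c) := by field_simp
      rw [this, le_div_iff₀ (by positivity)]; linarith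
    have h4 : 1 ≤ x ^ 2 * (2 * (1 + x ^ 2)⁻¹) := by
      rw [← mul_assoc, ← div_eq_mul_inv, le_div_iff₀ (by positivity)]; linarith
    have h5 : kap ^ 2 * x ^ 2 * Real.sin (π * x) ^ 2 ≤
        kap ^ 2 * x ^ 2 * (2 / kap ^ 2 * (P / (2 * c) * Q x + 2 * (1 + x ^ 2)⁻¹)) := by
      have : kap ^ 2 * x ^ 2 * (2 / kap ^ 2 * (P / (2 * c) * Q x + 2 * (1 + x ^ 2)⁻¹)) =
        2 * (x ^ 2 * (P / (2 * c) * Q x) + x ^ 2 * (2 * (1 + x ^ 2)⁻¹)) := by field_simp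
      rw [this]; linarith
    exact le_of_mul_le_mul_left h5 (by positivity)
  set G : ℝ → ℝ := fun x => 2 / kap ^ 2 * (P / (2 * c) * Q x + 2 * (1 + x ^ 2)⁻¹) with hG
  have hGi : Integrable G := ((hQ.const_mul _).add (integrable_inv_one_add_sq.const_mul 2)).const_mul _
  have hGi2 : Integrable fun x => G x + G (x + 1 / 2) := hGi.add (hGi.comp_add_right (1 / 2))
  have one : IntegrableOn (fun _ : ℝ => (1:ℝ)) (Set.Ioi 1) := by
    refine Integrable.mono' hGi2.integrableOn aestronglyMeasurable_const ?_
    filter_upwards [ae_restrict_mem measurableSet_Ioi] with x hx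
    have hx : 1 < x := hx
    have h1 := b2 x hx.le
    have h2 := b2 (x + 1 / 2) (by linarith)
    have e : Real.sin (π * (x + 1 / 2)) = Real.cos (π * x) := by
      rw [← Real.sin_add_pi_div_two]; congr 1; ring
    rw [e] at h2
    have := Real.sin_sq_add_cos_sq (π * x)
    rw [norm_one, hG]
    simp only
    linarith
  rw [integrableOn_const_iff] at one
  simp at one

lemma lin_nonneg {b : ℝ} (h : ∀ n : ℤ, 0 ≤ 1 + b * n) : b = 0 := by
  have key : ∀ b : ℝ, (∀ n : ℤ, 0 ≤ 1 + b * n) → 0 ≤ b := by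
    intro b h
    by_contra hb
    push Not at hb
    obtain ⟨n, hn⟩ := exists_nat_gt (1 / (-b))
    have := h n
    rw [div_lt_iff₀ (by linarith)] at hn
    push_cast at this
    linarith
  apply le_antisymm
  · have := key (-b) (fun n => by have := h (-n); push_cast at this; linarith)
    linarith
  · exact key b h

lemma eq_forward {R : ℝ → ℝ} (hR : Integrable R) (hnn : ∀ x, 0 ≤ R x) (h0 : 1 ≤ R 0) {F : ℂ → ℂ}
    (hF' : Differentiable ℂ F) (hFR : ∀ x : ℝ, F x = (R x : ℂ)) {K : ℝ} (hK0 : 0 < K)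
    (hK : ∀ z : ℂ, ‖F z‖ ≤ K * Real.exp (2 * π * |z.im|)) (hM : Mpc R = lam) :
    ∀ z, pF z ≠ 0 → F z = (pF z ^ 2)⁻¹ * hF z ^ 2 := by
  have hk := kap_pos
  have hl := lam_pos
  have hbasic := ineq_basic hR hnn hF' hFR hK0 hK
  rw [hM] at hbasic
  have R0 : R 0 = 1 := by
    apply le_antisymm _ h0
    by_contra hcon
    push Not at hcon
    nlinarith
  have nodes : ∀ ξ : ℝ, hF ξ = 0 → 2 * π ^ 2 * ξ ^ 2 ≠ 1 → R ξ = 0 := by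
    intro ξ h1 h2
    have := ineq_main hR hnn hF' hFR hK0 hK h1
    rw [hM, R0] at this
    have hc := cc_pos h1 h2
    apply le_antisymm _ (hnn ξ)
    by_contra hcon
    push Not at hcon
    have := mul_pos hc hcon
    linarith
  set A : ℂ → ℂ := fun z => F z * pF z ^ 2 with hAdef
  have hA : Differentiable ℂ A := hF'.mul (pF_diff.pow 2)
  have hAd : ∀ z, deriv A z = deriv F z * pF z ^ 2 + F z * (2 * pF z * deriv pF z) := by
    intro z
    have := (hF' z).hasDerivAt.mul ((pF_diff z).hasDerivAt.pow 2)
    have h2 := this.deriv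
    have e : A = F * pF ^ 2 := rfl
    rw [e, h2]
    simp
  obtain ⟨ψ, hψ, hψA⟩ := quot_entire hA (by
    intro ξ h1
    rw [hAd]
    simp only [hAdef]
    by_cases h2 : 2 * π ^ 2 * ξ ^ 2 = 1
    · have : pF ξ = 0 := by rw [pF_ofReal, h2]; simp
      rw [this]; simp
    · have h3 := nodes ξ h1 h2
      rw [deriv_zero_of_min hnn hF' hFR h3, hFR, h3]
      simp)
  have hψ0 : ψ 0 = 1 := by
    have := hψA 0
    have h2 := hFR 0
    rw [Complex.ofReal_zero, R0] at h2
    simp only [hAdef] at this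
    rw [hF_zero, pF_zero, h2] at this
    simpa using this
  set C := K * (1 + 2 * π ^ 2) ^ 2 / (kap / 8) ^ 2 with hCdef
  obtain ⟨b, c, hbc⟩ := quad_poly hψ (C := C) (by
    intro n z hz
    have hr := rho_pos n
    have h1 : 1 ≤ ‖z‖ := by linarith [sqB_norm_ge hz, rho_ge n]
    have h2 := hF_ge hz
    have h3 := sqB_norm_le hz
    have h4 := pF_le h1
    have h5 := hK z
    have h6 : kap / 8 * ‖z‖ * Real.exp (π * |z.im|) ≤ ‖hF z‖ := by
      refine le_trans ?_ h2
      have : kap / 8 * ‖z‖ ≤ kap / 4 * rho n := by nlinarith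
      gcongr
    have h7 : ‖ψ z‖ * ‖hF z‖ ^ 2 = ‖F z‖ * ‖pF z‖ ^ 2 := by
      rw [← norm_pow, ← norm_pow, ← norm_mul, ← norm_mul, hψA]
    have he : Real.exp (π * |z.im|) ^ 2 = Real.exp (2 * π * |z.im|) := by
      rw [← Real.exp_nat_mul]; congr 1; push_cast; ring
    have hE := Real.exp_pos (π * |z.im|)
    have h8 : ‖ψ z‖ * (kap / 8 * ‖z‖ * Real.exp (π * |z.im|)) ^ 2 ≤
        K * Real.exp (2 * π * |z.im|) * ((1 + 2 * π ^ 2) * ‖z‖ ^ 2) ^ 2 := by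
      calc _ ≤ ‖ψ z‖ * ‖hF z‖ ^ 2 := by gcongr
        _ = ‖F z‖ * ‖pF z‖ ^ 2 := h7
        _ ≤ _ := by gcongr
    have hz0 : 0 < ‖z‖ := by linarith
    have hpos : 0 < (kap / 8 * ‖z‖ * Real.exp (π * |z.im|)) ^ 2 := by positivity
    refine le_of_mul_le_mul_right (h8.trans (le_of_eq ?_)) hpos
    rw [← he, hCdef]
    field_simp)
  rw [hψ0] at hbc
  -- restriction to the reals
  have hreal : ∀ x : ℝ, ((R x * (1 - 2 * π ^ 2 * x ^ 2) ^ 2 : ℝ) : ℂ) = (1 + b * x + c * x ^ 2) * ((hr x ^ 2 : ℝ) : ℂ) := by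
    intro x
    have := hψA x
    simp only [hAdef] at this
    rw [hbc, hF_ofReal, pF_ofReal, hFR] at this
    rw [Complex.ofReal_mul, Complex.ofReal_pow, ← this]
    unfold hr
    push_cast
    ring
  have hint : ∀ n : ℤ, (((R n * (1 - 2 * π ^ 2 * (n:ℝ) ^ 2) ^ 2) : ℝ) : ℂ) = 1 + b * n + c * n ^ 2 := by
    intro n
    have := hreal n
    rw [hr_int] at this
    simpa using this
  have i1 := congrArg Complex.im (hint 1)
  have i2 := congrArg Complex.im (hint (-1))
  rw [Complex.ofReal_im] at i1 i2
  simp at i1 i2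
  have bim : b.im = 0 := by linarith
  have cim : c.im = 0 := by linarith
  obtain ⟨b, rfl⟩ : ∃ r : ℝ, b = r := ⟨b.re, Complex.ext (by simp) (by simp [bim])⟩
  obtain ⟨c, rfl⟩ : ∃ r : ℝ, c = r := ⟨c.re, Complex.ext (by simp) (by simp [cim])⟩
  have hreal' : ∀ x : ℝ, R x * (1 - 2 * π ^ 2 * x ^ 2) ^ 2 = (1 + b * x + c * x ^ 2) * hr x ^ 2 := by
    intro x; exact_mod_cast hreal x
  have hint' : ∀ n : ℤ, 0 ≤ 1 + b * n + c * (n:ℝ) ^ 2 := by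
    intro n
    have := hreal' n
    rw [hr_int, mul_one] at this
    rw [← this]
    exact mul_nonneg (hnn _) (sq_nonneg _)
  have c0 : 0 ≤ c := by
    by_contra hc
    push Not at hc
    obtain ⟨n, hn⟩ := exists_nat_gt (1 / (-c) + 1)
    have a1 := hint' n
    have a2 := hint' (-n)
    push_cast at a1 a2
    have hc' : 0 < 1 / (-c) := by apply one_div_pos.2; linarith
    have h3 : 1 / (-c) < n := by linarith
    rw [div_lt_iff₀ (by linarith)] at h3
    have h4 : (1:ℝ) ≤ n := by linarith
    nlinarith
  have c1 : c = 0 := by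
    by_contra hc
    refine no_quad (Q := fun x => R x + R (-x)) (hR.add hR.comp_neg) (lt_of_le_of_ne c0 (Ne.symm hc)) ?_
    intro x
    have a1 := hreal' x
    have a2 := hreal' (-x)
    have e : hr (-x) = hr x := by unfold hr; simp
    rw [e, neg_sq] at a2
    linear_combination a1 + a2
  subst c1
  have b0 : b = 0 := lin_nonneg (fun n => by have := hint' n; linarith)
  subst b0
  intro z hz
  have := hψA z
  rw [hbc] at this
  simp only [hAdef] at this
  rw [inv_mul_eq_div, eq_div_iff (pow_ne_zero 2 hz), ← this]
  simp

lemma form_eq (z : ℂ) : (Complex.cos ((π : ℂ) * z) -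
              (Real.sqrt 2 : ℂ) * (π : ℂ) * z *
                ((Real.cos invSqrt2 / Real.sin invSqrt2 : ℝ) : ℂ) *
                Complex.sin ((π : ℂ) * z)) = hF z := by
  unfold hF kap
  push_cast
  ring

theorem one_delta_problem
    (R : ℝ → ℝ) (hadm : IsAdmissible R) (hnonneg : ∀ x : ℝ, 0 ≤ R x) (h0 : 1 ≤ R 0) :
    invSqrt2 * (Real.cos invSqrt2 / Real.sin invSqrt2) - 1 / 2 ≤ Mpc R ∧
    (Mpc R = invSqrt2 * (Real.cos invSqrt2 / Real.sin invSqrt2) - 1 / 2 ↔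
      ∃ F : ℂ → ℂ, Differentiable ℂ F ∧
        (∀ z : ℂ, 1 - 2 * (π : ℂ) ^ 2 * z ^ 2 ≠ 0 →
          F z = ((1 - 2 * (π : ℂ) ^ 2 * z ^ 2) ^ 2)⁻¹ *
            (Complex.cos ((π : ℂ) * z) -
              (Real.sqrt 2 : ℂ) * (π : ℂ) * z *
                ((Real.cos invSqrt2 / Real.sin invSqrt2 : ℝ) : ℂ) *
                Complex.sin ((π : ℂ) * z)) ^ 2) ∧
        ∀ x : ℝ, (R x : ℂ) = F x) := by
  obtain ⟨hR, F, hFd, hFt, hFR⟩ := hadm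
  obtain ⟨K, hK0, hK⟩ := growth hFd hFt (by simp only [hFR]; exact hR.ofReal)
  have hl := lam_pos
  have hlam : invSqrt2 * (Real.cos invSqrt2 / Real.sin invSqrt2) - 1 / 2 = lam := rfl
  rw [hlam]
  refine ⟨?_, fun hM => ?_, ?_⟩
  · have := ineq_basic hR hnonneg hFd hFR hK0 hK
    nlinarith
  · refine ⟨F, hFd, fun z hz => ?_, fun x => (hFR x).symm⟩
    rw [form_eq]
    exact eq_forward hR hnonneg h0 hFd hFR hK0 hK hM z hz
  · rintro ⟨F', hd, hform, hx⟩
    refine eq_back hR hd (fun z hz => ?_) hx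
    have := hform z hz
    rwa [form_eq] at this
end

section
/- Fix Δ ≥ 1 and for β > 0 define s_{Δ,β}^±(x) = r_{Δβ}^±(Δx), which are entire functions of exponential type 2πΔ majorizing and minorizing χ_{[−β,β]} on ℝ. Then there exist constants C > 0 and β₀ > 0 (which may depend on Δ) such that for all β ≥ β₀ and each choice of sign, |(1/2)·M(s_{Δ,β}^±) − (β − 1/2 ± 1/(2Δ) + 1/(2π²β))| ≤ C/β². -/
open Filter MeasureTheory Real Complex

/-- The Beurling function `H₀(x) = (sin πx/π)² {Σ_{m∈ℤ} sgn(m)/(x−m)² + 2/x}`. -/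
noncomputable def H0 (x : ℝ) : ℝ :=
  (Real.sin (π * x) / π) ^ 2 * ((∑' m : ℤ, (Int.sign m : ℝ) / (x - m) ^ 2) + 2 / x)

/-- `H₁(x) = (sin πx/(πx))²`. -/
noncomputable def H1 (x : ℝ) : ℝ := (Real.sin (π * x) / (π * x)) ^ 2

/-- Beurling's majorant `H⁺ = H₀ + H₁` of `sgn`. -/
noncomputable def Hplus (x : ℝ) : ℝ := H0 x + H1 x

/-- Beurling's minorant `H⁻ = H₀ − H₁` of `sgn`. -/
noncomputable def Hminus (x : ℝ) : ℝ := H0 x - H1 x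

/-- The Beurling–Selberg majorant `r_β⁺(x) = ½{H⁺(x+β) + H⁺(−x+β)}` of `χ_{[−β,β]}`. -/
noncomputable def rPlus (β : ℝ) (x : ℝ) : ℝ := (Hplus (x + β) + Hplus (-x + β)) / 2

/-- The Beurling–Selberg minorant `r_β⁻(x) = ½{H⁻(x+β) + H⁻(−x+β)}` of `χ_{[−β,β]}`. -/
noncomputable def rMinus (β : ℝ) (x : ℝ) : ℝ := (Hminus (x + β) + Hminus (-x + β)) / 2

/-- The dilated Beurling–Selberg majorant `s⁺_{Δ,β}(x) = r⁺_{Δβ}(Δx)`. -/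
noncomputable def sPlus (Δ β : ℝ) (x : ℝ) : ℝ := rPlus (Δ * β) (Δ * x)

/-- The dilated Beurling–Selberg minorant `s⁻_{Δ,β}(x) = r⁻_{Δβ}(Δx)`. -/
noncomputable def sMinus (Δ β : ℝ) (x : ℝ) : ℝ := rMinus (Δ * β) (Δ * x)


lemma H1_nonneg (x : ℝ) : 0 ≤ H1 x := sq_nonneg _

lemma H1_le_inv (x : ℝ) : H1 x ≤ 1 / x ^ 2 := by
  unfold H1
  rcases eq_or_ne x 0 with rfl | hx
  · simp
  rw [div_pow, mul_pow]
  have h1 : Real.sin (π * x) ^ 2 ≤ 1 := Real.sin_sq_le_one _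
  have hpi : 1 ≤ π ^ 2 := by nlinarith [Real.pi_gt_three]
  have hx2 : 0 < x ^ 2 := by positivity
  rw [div_le_div_iff₀ (by positivity) hx2]
  nlinarith

lemma H1_le_one (x : ℝ) : H1 x ≤ 1 := by
  unfold H1
  rcases eq_or_ne x 0 with rfl | hx
  · simp
  rw [div_pow, div_le_one (by positivity)]
  exact sq_le_sq.2 Real.abs_sin_le_abs

lemma H1_even (x : ℝ) : H1 (-x) = H1 x := by
  unfold H1; simp

lemma H1_measurable : Measurable H1 := by
  unfold H1; fun_prop

lemma H1_integrable : Integrable H1 := by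
  have h : Integrable (fun x : ℝ => 2 * (1 + x ^ 2)⁻¹) := integrable_inv_one_add_sq.const_mul 2
  refine h.mono' H1_measurable.aestronglyMeasurable (Eventually.of_forall fun x => ?_)
  rw [Real.norm_of_nonneg (H1_nonneg x), ← div_eq_mul_inv, le_div_iff₀ (by positivity)]
  have h1 := H1_le_one x
  have h2 : H1 x * x ^ 2 ≤ 1 := by
    rcases eq_or_ne x 0 with rfl | hx
    · simp
    have := H1_le_inv x
    rwa [le_div_iff₀ (by positivity)] at this
  nlinarith

lemma sin_pi_sub_int (x : ℝ) (n : ℤ) : Real.sin (π * (x - n)) ^ 2 = Real.sin (π * x) ^ 2 := by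
  have : π * (x - n) = π * x - n * π := by ring
  rw [this, Real.sin_sub_int_mul_pi, mul_pow]
  have h : (((-1 : ℝ)) ^ n) ^ 2 = 1 := by
    rw [← zpow_natCast, ← zpow_mul, mul_comm n, zpow_mul]; simp
  rw [h, one_mul]

lemma hasSum_H1 (x : ℝ) (hx : ∀ m : ℤ, x ≠ m) : HasSum (fun m : ℤ => H1 (x - m)) 1 := by
  have hL2 : MemLp (fun t : ℝ => Complex.exp (2 * π * Complex.I * x * t)) 2
      (volume.restrict (Set.Ioc (0:ℝ) 1)) := by
    refine MemLp.of_bound (C := 1) ?_ ?_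
    · exact (by fun_prop : Continuous _).aestronglyMeasurable
    · refine Eventually.of_forall fun t => ?_
      have : (2 * π * Complex.I * x * t : ℂ) = ((2 * π * x * t : ℝ) : ℂ) * Complex.I := by
        push_cast; ring
      rw [this, Complex.norm_exp_ofReal_mul_I]
  have h := hasSum_sq_fourierCoeffOn (zero_lt_one) hL2
  have e1 : ((1:ℝ) - 0)⁻¹ • ∫ t in (0:ℝ)..1, ‖Complex.exp (2 * π * Complex.I * x * t)‖ ^ 2 = 1 := by
    have : ∀ t : ℝ, ‖Complex.exp (2 * π * Complex.I * x * t)‖ = 1 := fun t => by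
      have : (2 * π * Complex.I * x * t : ℂ) = ((2 * π * x * t : ℝ) : ℂ) * Complex.I := by
        push_cast; ring
      rw [this, Complex.norm_exp_ofReal_mul_I]
    simp [this]
  rw [e1] at h
  convert h using 2 with m
  have hxm : x - m ≠ 0 := sub_ne_zero.2 (hx m)
  rw [fourierCoeffOn_eq_integral]
  have e2 : ∀ t : ℝ, (fourier (-m) (t : AddCircle ((1:ℝ) - 0)) • Complex.exp (2 * π * Complex.I * x * t) : ℂ)
      = Complex.exp ((2 * π * Complex.I * (x - m)) * t) := fun t => by
    rw [fourier_coe_apply, smul_eq_mul, ← Complex.exp_add]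
    congr 1
    push_cast
    ring
  simp_rw [e2]
  have hc : (2 * π * Complex.I * (x - m) : ℂ) ≠ 0 := by
    have : (x - m : ℂ) ≠ 0 := by exact_mod_cast hxm
    have hpi : (π : ℂ) ≠ 0 := by exact_mod_cast Real.pi_ne_zero
    simp [this, hpi]
  rw [integral_exp_mul_complex hc]
  have e3 : (2 * π * Complex.I * (x - m) : ℂ) * (1:ℝ) = Complex.I * ((2 * (π * (x - m)) : ℝ) : ℂ) := by
    push_cast; ring
  have e4 : ‖(2 * π * Complex.I * (x - m) : ℂ)‖ = 2 * (π * |x - m|) := by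
    have : (2 * π * Complex.I * (x - m) : ℂ) = Complex.I * ((2 * (π * (x - m)) : ℝ) : ℂ) := by
      push_cast; ring
    rw [this, norm_mul, Complex.norm_I, Complex.norm_real, Real.norm_eq_abs, abs_mul, abs_mul,
      abs_of_pos Real.pi_pos]
    simp
  simp only [Complex.ofReal_zero, mul_zero, Complex.exp_zero]
  rw [e3, norm_smul, norm_div, norm_div, e4, Complex.norm_exp_I_mul_ofReal_sub_one]
  unfold H1
  rw [show 2 * (π * (x - m)) / 2 = π * (x - m) by ring]
  simp only [norm_mul, Real.norm_eq_abs, mul_pow, div_pow, sq_abs]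
  norm_num
  field_simp

lemma ae_ne_int : ∀ᵐ x : ℝ, ∀ m : ℤ, x ≠ m := by
  rw [ae_all_iff]
  intro m
  exact Measure.ae_ne volume (m : ℝ)

lemma integral_H1 : ∫ x, H1 x = 1 := by
  have h1 := H1_integrable.hasSum_intervalIntegral_comp_add_int
  simp_rw [intervalIntegral.integral_of_le zero_le_one] at h1
  have hi : ∀ n : ℤ, Integrable (fun x : ℝ => H1 (x + n)) (volume.restrict (Set.Ioc 0 1)) :=
    fun n => (H1_integrable.comp_add_right (n:ℝ)).integrableOn
  have h2 := hasSum_integral_of_summable_integral_norm (F := fun (n : ℤ) (x : ℝ) => H1 (x + n))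
    (μ := volume.restrict (Set.Ioc 0 1)) hi (by
      have : ∀ x : ℝ, ‖H1 x‖ = H1 x := fun x => Real.norm_of_nonneg (H1_nonneg x)
      simp_rw [this]
      exact h1.summable)
  rw [h1.unique h2]
  have : (fun x : ℝ => ∑' n : ℤ, H1 (x + n)) =ᵐ[volume.restrict (Set.Ioc 0 1)] fun _ => 1 := by
    filter_upwards [ae_restrict_of_ae ae_ne_int] with x hx
    have := (Equiv.neg ℤ).hasSum_iff.2 (hasSum_H1 x hx)
    simpa [Function.comp_def] using this.tsum_eq
  rw [integral_congr_ae this]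
  simp

lemma hasSum_telescope (x : ℝ) (hx : 0 < x) :
    HasSum (fun n : ℕ => 1 / (x + n) - 1 / (x + n + 1)) (1 / x) := by
  rw [hasSum_iff_tendsto_nat_of_nonneg]
  · have e : ∀ n : ℕ, ∑ i ∈ Finset.range n, (1 / (x + i) - 1 / (x + i + 1)) = 1 / x - 1 / (x + n) := by
      intro n
      have := Finset.sum_range_sub' (fun i : ℕ => 1 / (x + i)) n
      simp only [Nat.cast_zero, add_zero] at this
      rw [← this]
      refine Finset.sum_congr rfl fun i _ => ?_
      push_cast; rw [add_assoc]
    simp_rw [e]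
    have ht : Tendsto (fun n : ℕ => 1 / (x + n)) atTop (nhds 0) := by
      simp_rw [one_div]
      exact (tendsto_atTop_add_const_left _ x tendsto_natCast_atTop_atTop).inv_tendsto_atTop
    simpa using ht.const_sub (1 / x)
  · intro n
    rw [sub_nonneg]
    have : (0:ℝ) ≤ n := n.cast_nonneg
    exact one_div_le_one_div_of_le (by linarith) (by linarith)

lemma H0_sub_one (x : ℝ) (hx0 : 0 < x) (hx : ∀ m : ℤ, x ≠ m) : |H0 x - 1| ≤ H1 x := by
  have hs : Real.sin (π * x) ≠ 0 := by
    rw [Real.sin_ne_zero_iff]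
    intro n hn
    apply hx n
    have := Real.pi_ne_zero
    have h2 : π * (n : ℝ) = π * x := by linarith
    exact (mul_left_cancel₀ this h2).symm
  set s : ℝ := (Real.sin (π * x) / π) ^ 2 with hsdef
  have hspos : 0 < s := by positivity
  have hg : HasSum (fun m : ℤ => 1 / (x - m) ^ 2) (1 / s) := by
    have := (hasSum_H1 x hx).div_const s
    have e : (fun m : ℤ => 1 / (x - m) ^ 2) = fun m : ℤ => H1 (x - m) / s := by
      funext m
      have hxm : x - m ≠ 0 := sub_ne_zero.2 (hx m)
      unfold H1
      rw [div_pow, sin_pi_sub_int, hsdef, div_pow]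
      have hs2 : Real.sin (π * x) ^ 2 ≠ 0 := pow_ne_zero 2 hs
      generalize Real.sin (π * x) ^ 2 = q at hs2
      field_simp
    rw [e]; exact this
  have hsum : Summable (fun n : ℕ => 1 / (x + (n + 1)) ^ 2) := by
    have := hg.summable.comp_injective (i := fun n : ℕ => (-(n + 1) : ℤ)) (by
      intro a b h; simpa using h)
    refine this.congr fun n => ?_
    simp
    ring
  set T : ℝ := ∑' n : ℕ, 1 / (x + (n + 1)) ^ 2 with hT
  have hTs : HasSum (fun n : ℕ => 1 / (x + (n + 1)) ^ 2) T := hsum.hasSum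
  have hf : HasSum (fun m : ℤ => (1 - (Int.sign m : ℝ)) * (1 / (x - m) ^ 2)) (1 / x ^ 2 + 2 * T) := by
    refine HasSum.of_nat_of_neg_add_one ?_ ?_
    · convert hasSum_single (f := fun n : ℕ => (1 - (Int.sign (n:ℤ) : ℝ)) * (1 / (x - ((n:ℤ):ℝ)) ^ 2)) 0 ?_ using 1
      · simp
      · intro n hn
        rw [Int.sign_natCast_of_ne_zero hn]; simp
    · have e : (fun n : ℕ => (1 - (Int.sign (-((n:ℤ) + 1)) : ℝ)) * (1 / (x - ((-((n:ℤ) + 1) : ℤ) : ℝ)) ^ 2))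
          = fun n : ℕ => 2 * (1 / (x + (n + 1)) ^ 2) := by
        funext n
        rw [Int.sign_eq_neg_one_of_neg (by omega)]
        push_cast
        rw [show x - -((n:ℝ) + 1) = x + (n + 1) by ring]
        ring
      rw [e]; exact hTs.mul_left 2
  have hsg : ∑' m : ℤ, (Int.sign m : ℝ) / (x - m) ^ 2 = 1 / s - (1 / x ^ 2 + 2 * T) := by
    refine HasSum.tsum_eq ?_
    have e : (fun m : ℤ => (Int.sign m : ℝ) / (x - m) ^ 2) =
        fun m : ℤ => 1 / (x - m) ^ 2 - (1 - (Int.sign m : ℝ)) * (1 / (x - m) ^ 2) := by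
      funext m; ring
    rw [e]; exact hg.sub hf
  have hup : T ≤ 1 / x := by
    refine hasSum_le (fun n => ?_) hTs (hasSum_telescope x hx0)
    have : (0:ℝ) ≤ n := n.cast_nonneg
    have h1 : 0 < x + n := by linarith
    rw [div_sub_div _ _ (by positivity) (by positivity), div_le_div_iff₀ (by positivity) (by positivity)]
    nlinarith
  have hlow : 1 / (x + 1) ≤ T := by
    refine hasSum_le (fun n => ?_) (hasSum_telescope (x + 1) (by linarith)) hTs
    have : (0:ℝ) ≤ n := n.cast_nonneg
    have h1 : 0 < x + n := by linarith
    rw [div_sub_div _ _ (by positivity) (by positivity), div_le_div_iff₀ (by positivity) (by positivity)]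
    nlinarith
  have hH1 : H1 x = s * (1 / x ^ 2) := by
    unfold H1; rw [hsdef]; field_simp
  have hH0 : H0 x - 1 = s * (2 / x - 1 / x ^ 2 - 2 * T) := by
    unfold H0; rw [hsg, ← hsdef]; field_simp; ring
  rw [hH0, hH1, abs_mul, abs_of_pos hspos]
  refine mul_le_mul_of_nonneg_left ?_ hspos.le
  have h3 : 1 / x - 1 / x ^ 2 ≤ 1 / (x + 1) := by
    rw [div_sub_div _ _ (by positivity) (by positivity), div_le_div_iff₀ (by positivity) (by positivity)]
    nlinarith [pow_pos hx0 3]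
  have h4 : 2 / x = 2 * (1 / x) := by ring
  rw [abs_le]; constructor <;> linarith

lemma H0_odd (x : ℝ) : H0 (-x) = - H0 x := by
  unfold H0
  have : ∑' m : ℤ, (Int.sign m : ℝ) / (-x - m) ^ 2 = - ∑' m : ℤ, (Int.sign m : ℝ) / (x - m) ^ 2 := by
    rw [← (Equiv.neg ℤ).tsum_eq, ← tsum_neg]
    refine tsum_congr fun m => ?_
    simp only [Equiv.neg_apply, Int.sign_neg]
    push_cast
    rw [show -x - -(m:ℝ) = -(x - m) by ring, neg_sq, neg_div]
  rw [this]
  simp only [mul_neg, Real.sin_neg, neg_div, neg_sq, div_neg]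
  ring

lemma sign_measurable : Measurable Real.sign := by
  unfold Real.sign
  exact Measurable.ite measurableSet_Iio measurable_const
    (Measurable.ite measurableSet_Ioi measurable_const measurable_const)

lemma H0_measurable : Measurable H0 := by
  unfold H0
  have : Measurable (fun x : ℝ => ∑' m : ℤ, (Int.sign m : ℝ) / (x - m) ^ 2) :=
    Measurable.tsum fun m => by fun_prop
  fun_prop

lemma H0_sub_sign : ∀ᵐ x : ℝ, |H0 x - Real.sign x| ≤ H1 x := by
  filter_upwards [ae_ne_int] with x hx
  rcases lt_trichotomy x 0 with h | h | h
  · have := H0_sub_one (-x) (by linarith) (fun m hm => hx (-m) (by push_cast; linarith))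
    rw [H0_odd, H1_even] at this
    rw [Real.sign_of_neg h, ← abs_neg]
    convert this using 2; ring
  · exact absurd h (by simpa using hx 0)
  · rw [Real.sign_of_pos h]; exact H0_sub_one x h hx

lemma e_integrable : Integrable (fun x => H0 x - Real.sign x) :=
  H1_integrable.mono' (H0_measurable.sub sign_measurable).aestronglyMeasurable H0_sub_sign

lemma integral_e : ∫ x, (H0 x - Real.sign x) = 0 := by
  have h := integral_neg_eq_self (fun x => H0 x - Real.sign x) volume
  have : ∀ x, H0 (-x) - Real.sign (-x) = -(H0 x - Real.sign x) := fun x => by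
    rw [H0_odd, Real.sign_neg]; ring
  simp_rw [this] at h
  rw [integral_neg] at h
  linarith

lemma tail_H1 (β : ℝ) (hβ : 1 ≤ β) :
    |(∫ x in Set.Ioi β, H1 x) - 1 / (2 * π ^ 2 * β)| ≤ 1 / β ^ 2 := by
  have hβ0 : 0 < β := by linarith
  have hpi := Real.pi_gt_three
  have hcube : ∀ x ∈ Set.Ioi β, x ^ (-3 : ℝ) = 1 / x ^ 3 := fun x hx => by
    have hx0 : 0 < x := hβ0.trans hx
    rw [Real.rpow_neg hx0.le, one_div]; norm_cast
  have hi3 : IntegrableOn (fun x : ℝ => 1 / x ^ 3) (Set.Ioi β) :=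
    (integrableOn_Ioi_rpow_of_lt (by norm_num : (-3 : ℝ) < -1) hβ0).congr_fun hcube measurableSet_Ioi
  have hv3 : ∫ x in Set.Ioi β, 1 / x ^ 3 = 1 / (2 * β ^ 2) := by
    rw [← setIntegral_congr_fun measurableSet_Ioi hcube,
      integral_Ioi_rpow_of_lt (by norm_num : (-3 : ℝ) < -1) hβ0]
    have : β ^ ((-3 : ℝ) + 1) = 1 / β ^ 2 := by
      rw [show (-3 : ℝ) + 1 = -2 by norm_num, Real.rpow_neg hβ0.le, one_div]; norm_cast
    rw [this]; field_simp; norm_num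
  have hbd : ∀ x ∈ Set.Ioi β, ‖Real.sin (2 * π * x) / (π * x ^ 3)‖ ≤ 1 / x ^ 3 := fun x hx => by
    have hx0 : 0 < x := hβ0.trans hx
    rw [norm_div, Real.norm_eq_abs, Real.norm_of_nonneg (by positivity)]
    have h1 := Real.abs_sin_le_one (2 * π * x)
    have h3 : 0 < x ^ 3 := by positivity
    rw [div_le_div_iff₀ (by positivity) h3]
    nlinarith
  have his : IntegrableOn (fun x : ℝ => Real.sin (2 * π * x) / (π * x ^ 3)) (Set.Ioi β) := by
    refine Integrable.mono' hi3 (by fun_prop : Measurable _).aestronglyMeasurable ?_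
    exact (ae_restrict_iff' measurableSet_Ioi).2 (Eventually.of_forall hbd)
  have hsb : |∫ x in Set.Ioi β, Real.sin (2 * π * x) / (π * x ^ 3)| ≤ 1 / (2 * β ^ 2) := by
    rw [← hv3]
    exact norm_integral_le_of_norm_le hi3
      ((ae_restrict_iff' measurableSet_Ioi).2 (Eventually.of_forall hbd))
  have hiH : IntegrableOn (fun x : ℝ => 2 * π ^ 2 * H1 x) (Set.Ioi β) :=
    (H1_integrable.const_mul _).integrableOn
  have hd : ∀ x ∈ Set.Ici β, HasDerivAt
      (fun x : ℝ => -(1 / x) - Real.sin (2 * π * x) / (2 * π * x ^ 2))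
      (2 * π ^ 2 * H1 x + Real.sin (2 * π * x) / (π * x ^ 3)) x := fun x hx => by
    have hx0 : 0 < x := lt_of_lt_of_le hβ0 hx
    have d1 : HasDerivAt (fun x : ℝ => -(1 / x)) (1 / x ^ 2) x := by
      have := (hasDerivAt_inv hx0.ne').fun_neg
      simpa using this
    have d2 : HasDerivAt (fun x : ℝ => Real.sin (2 * π * x)) (Real.cos (2 * π * x) * (2 * π)) x := by
      simpa using ((hasDerivAt_id x).const_mul (2 * π)).sin
    have d3 : HasDerivAt (fun x : ℝ => 2 * π * x ^ 2) (2 * π * (2 * x)) x := by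
      simpa using (hasDerivAt_pow 2 x).const_mul (2 * π)
    have d := d1.sub (d2.div d3 (by positivity))
    refine d.congr_deriv ?_
    have hc : Real.cos (2 * π * x) = 1 - 2 * Real.sin (π * x) ^ 2 := by
      rw [show 2 * π * x = 2 * (π * x) by ring, Real.cos_two_mul, Real.cos_sq']; ring
    unfold H1
    rw [hc]
    field_simp
    ring
  have hlim : Tendsto (fun x : ℝ => -(1 / x) - Real.sin (2 * π * x) / (2 * π * x ^ 2)) atTop (nhds 0) := by
    have t1 : Tendsto (fun x : ℝ => 2 * (1 / x)) atTop (nhds 0) := by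
      simpa using (tendsto_inv_atTop_zero (𝕜 := ℝ)).const_mul 2
    refine squeeze_zero_norm' ?_ t1
    filter_upwards [eventually_ge_atTop 1] with x hx
    have hx0 : 0 < x := by linarith
    have a1 : |Real.sin (2 * π * x) / (2 * π * x ^ 2)| ≤ 1 / x := by
      rw [abs_div, abs_of_pos (by positivity : 0 < 2 * π * x ^ 2),
        div_le_div_iff₀ (by positivity) hx0]
      have h1 := Real.abs_sin_le_one (2 * π * x)
      have : x ≤ x ^ 2 := by nlinarith
      nlinarith
    have a2 : |1 / x| = 1 / x := abs_of_pos (by positivity)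
    rw [Real.norm_eq_abs]
    calc _ ≤ |-(1 / x)| + |Real.sin (2 * π * x) / (2 * π * x ^ 2)| := abs_sub _ _
      _ ≤ _ := by rw [abs_neg, a2]; linarith
  have key := integral_Ioi_of_hasDerivAt_of_tendsto' hd (hiH.add his) hlim
  rw [integral_add hiH his, integral_const_mul] at key
  have hsβ : |Real.sin (2 * π * β) / (2 * π * β ^ 2)| ≤ 1 / (2 * β ^ 2) := by
    rw [abs_div, abs_of_pos (by positivity : 0 < 2 * π * β ^ 2),
        div_le_div_iff₀ (by positivity) (by positivity)]
    have h1 := Real.abs_sin_le_one (2 * π * β)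
    have : 0 < β ^ 2 := by positivity
    nlinarith
  set J := ∫ x in Set.Ioi β, H1 x
  set I3 := ∫ x in Set.Ioi β, Real.sin (2 * π * x) / (π * x ^ 3)
  set F := Real.sin (2 * π * β) / (2 * π * β ^ 2)
  have e : J - 1 / (2 * π ^ 2 * β) = (F - I3) / (2 * π ^ 2) := by
    have : 2 * π ^ 2 * J = 1 / β + F - I3 := by linarith
    have : J = (1 / β + F - I3) / (2 * π ^ 2) := by
      rw [eq_div_iff (by positivity)]; linarith
    rw [this]; field_simp; ring
  have hFI : |F - I3| ≤ 1 / β ^ 2 := by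
    have h5 := abs_sub F I3
    have : 1 / β ^ 2 = 1 / (2 * β ^ 2) + 1 / (2 * β ^ 2) := by field_simp; norm_num
    linarith
  rw [e, abs_div, abs_of_pos (by positivity : 0 < 2 * π ^ 2)]
  exact (div_le_self (abs_nonneg _) (by nlinarith)).trans hFI

lemma main_generic (Δ : ℝ) (hΔ : 1 ≤ Δ) (H : ℝ → ℝ) (ε : ℝ)
    (hE : Integrable (fun x => H x - Real.sign x))
    (hEb : ∀ᵐ x : ℝ, |H x - Real.sign x| ≤ 2 * H1 x)
    (hEi : ∫ x, (H x - Real.sign x) = ε) (β : ℝ) (hβ : 1 ≤ β) :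
    |(1 / 2) * Mpc (fun x => (H (Δ * x + Δ * β) + H (-(Δ * x) + Δ * β)) / 2)
      - (β - 1 / 2 + ε / (2 * Δ) + 1 / (2 * π ^ 2 * β))| ≤ 20 / β ^ 2 := by
  have hΔ0 : 0 < Δ := by linarith
  have hβ0 : 0 < β := by linarith
  set E : ℝ → ℝ := fun x => H x - Real.sign x with hEdef
  set A : ℝ → ℝ := fun x => E (Δ * (x + β)) with hA
  have hAi : Integrable A := (hE.comp_mul_left' hΔ0.ne').comp_add_right β
  have hAint : ∫ x, A x = ε / Δ := by
    rw [hA, integral_add_right_eq_self (fun x => E (Δ * x)) β, Measure.integral_comp_mul_left, hEi,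
      abs_of_pos (by positivity), smul_eq_mul]
    field_simp
  set B : ℝ → ℝ := fun x => H1 (Δ * (x + β)) with hB
  have hBi : Integrable B := (H1_integrable.comp_mul_left' hΔ0.ne').comp_add_right β
  have hBint : ∫ x, B x = 1 / Δ := by
    rw [hB, integral_add_right_eq_self (fun x => H1 (Δ * x)) β, Measure.integral_comp_mul_left,
      integral_H1, abs_of_pos (by positivity), smul_eq_mul]
    field_simp
  have hAb : ∀ᵐ x, |A x| ≤ 2 * B x := by
    have hq : Measure.QuasiMeasurePreserving (fun x : ℝ => Δ * (x + β)) volume volume := by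
      have h1 : Measure.QuasiMeasurePreserving (fun x : ℝ => Δ * x) volume volume := by
        refine ⟨by fun_prop, ?_⟩
        rw [Real.map_volume_mul_left hΔ0.ne']
        exact Measure.smul_absolutelyContinuous
      exact h1.comp (measurePreserving_add_right volume β).quasiMeasurePreserving
    exact hq.ae hEb
  have hASi : Integrable (fun x => A x * H1 x) :=
    hAi.mul_bdd (c := 1) H1_measurable.aestronglyMeasurable (Eventually.of_forall fun x => by
      rw [Real.norm_of_nonneg (H1_nonneg x)]; exact H1_le_one x)
  have hASb : |∫ x, A x * H1 x| ≤ 16 / β ^ 2 := by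
    have hpt : ∀ᵐ x, ‖A x * H1 x‖ ≤ 8 / β ^ 2 * (B x + H1 x) := by
      filter_upwards [hAb] with x hx
      rw [norm_mul, Real.norm_eq_abs, Real.norm_of_nonneg (H1_nonneg x)]
      have hBn : 0 ≤ B x := H1_nonneg _
      have hSn := H1_nonneg x
      have h1 : |A x| * H1 x ≤ 2 * B x * H1 x := mul_le_mul_of_nonneg_right hx hSn
      have hc : 8 / β ^ 2 = 2 * (4 / β ^ 2) := by ring
      have hcp : 0 < 4 / β ^ 2 := by positivity
      have h2 : ∀ y : ℝ, β / 2 ≤ |y| → H1 y ≤ 4 / β ^ 2 := fun y hy => by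
        refine (H1_le_inv y).trans ?_
        have : (β / 2) ^ 2 ≤ y ^ 2 := by
          rw [← sq_abs y]; gcongr
        have hb : 0 < (β / 2) ^ 2 := by positivity
        calc 1 / y ^ 2 ≤ 1 / (β / 2) ^ 2 := one_div_le_one_div_of_le hb this
          _ = 4 / β ^ 2 := by field_simp; norm_num
      rw [hc]
      rcases le_or_gt (β / 2) |x| with h | h
      · have := h2 x h
        nlinarith [mul_le_mul_of_nonneg_left this hBn]
      · have hBx : B x ≤ 4 / β ^ 2 := by
          apply h2
          rw [abs_lt] at h
          have h4 : β / 2 ≤ x + β := by linarith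
          have h5 : x + β ≤ Δ * (x + β) := by nlinarith
          exact (h4.trans h5).trans (le_abs_self _)
        nlinarith [mul_le_mul_of_nonneg_right hBx hSn]
    have := norm_integral_le_of_norm_le ((hBi.add H1_integrable).const_mul (8 / β ^ 2)) hpt
    simp only [Pi.add_apply] at this
    rw [integral_const_mul, integral_add hBi H1_integrable, hBint, integral_H1,
      Real.norm_eq_abs] at this
    refine this.trans ?_
    have h6 : 1 / Δ ≤ 1 := by rw [div_le_one hΔ0]; exact hΔ
    have h7 : 0 < 8 / β ^ 2 := by positivity
    have : 16 / β ^ 2 = 8 / β ^ 2 * 2 := by ring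
    rw [this]
    gcongr
    linarith
  -- the integral of the kernel over [-β, β]
  have hSint : ∫ x in Set.Ioc (-β) β, H1 x = 1 - 2 * ∫ x in Set.Ioi β, H1 x := by
    have h1 : ∫ x in Set.Iic (-β), H1 x = ∫ x in Set.Ioi β, H1 x := by
      have := integral_comp_neg_Iic (-β) H1
      simp_rw [H1_even, neg_neg] at this
      exact this
    have h2 := intervalIntegral.integral_Iic_sub_Iic (f := H1) (a := -β) (b := β)
      (μ := volume) H1_integrable.integrableOn H1_integrable.integrableOn
    rw [intervalIntegral.integral_of_le (by linarith)] at h2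
    have h3 := intervalIntegral.integral_Iic_add_Ioi (f := H1) (b := β)
      (μ := volume) H1_integrable.integrableOn H1_integrable.integrableOn
    rw [integral_H1] at h3
    linarith
  set χ : ℝ → ℝ := (Set.Ioc (-β) β).indicator (fun x => 1 - H1 x) with hχ
  have h1i : IntegrableOn (fun _ : ℝ => (1:ℝ)) (Set.Ioc (-β) β) := by
    simp
  have hχi : Integrable χ := by
    rw [hχ, integrable_indicator_iff measurableSet_Ioc]
    exact h1i.sub H1_integrable.integrableOn
  have hχint : ∫ x, χ x = 2 * β - 1 + 2 * ∫ x in Set.Ioi β, H1 x := by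
    rw [hχ, integral_indicator measurableSet_Ioc,
      integral_sub h1i H1_integrable.integrableOn, hSint]
    simp [hβ0.le]
    ring
  set P : ℝ → ℝ := fun x => A x - A x * H1 x with hP
  have hPi : Integrable P := hAi.sub hASi
  have hPint : ∫ x, P x = ε / Δ - ∫ x, A x * H1 x := by
    rw [hP, integral_sub hAi hASi, hAint]
  have hM : Mpc (fun x => (H (Δ * x + Δ * β) + H (-(Δ * x) + Δ * β)) / 2)
      = ∫ x, ((P x + P (-x)) / 2 + χ x) := by
    unfold Mpc
    refine integral_congr_ae ?_
    filter_upwards [Measure.ae_ne volume β, Measure.ae_ne volume (-β)] with x hx1 hx2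
    have e1 : H (Δ * x + Δ * β) = A x + Real.sign (Δ * (x + β)) := by
      simp only [hA, hEdef]; rw [mul_add]; ring
    have e2 : H (-(Δ * x) + Δ * β) = A (-x) + Real.sign (Δ * (-x + β)) := by
      simp only [hA, hEdef]; rw [mul_add, mul_neg]; ring
    have e3 : χ x = (Real.sign (Δ * (x + β)) + Real.sign (Δ * (-x + β))) / 2 * (1 - H1 x) := by
      rcases lt_or_gt_of_ne hx2 with h | h
      · rw [hχ, Set.indicator_of_notMem (by simp; intro h'; linarith),
          Real.sign_of_neg (mul_neg_of_pos_of_neg hΔ0 (by linarith)),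
          Real.sign_of_pos (mul_pos hΔ0 (by linarith))]
        ring
      · rw [Real.sign_of_pos (mul_pos hΔ0 (by linarith : 0 < x + β))]
        rcases lt_or_gt_of_ne hx1 with h' | h'
        · rw [hχ, Set.indicator_of_mem (Set.mem_Ioc.2 ⟨h, h'.le⟩),
            Real.sign_of_pos (mul_pos hΔ0 (by linarith))]
          ring
        · rw [hχ, Set.indicator_of_notMem (by simp; intro; linarith),
            Real.sign_of_neg (mul_neg_of_pos_of_neg hΔ0 (by linarith))]
          ring
    have e4 : pairCorKernel x = 1 - H1 x := rfl
    simp only [hP]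
    rw [e1, e2, e3, e4, H1_even]
    ring
  have hPn : Integrable (fun x => P (-x)) := hPi.comp_neg
  have hM2 : Mpc (fun x => (H (Δ * x + Δ * β) + H (-(Δ * x) + Δ * β)) / 2)
      = ε / Δ - (∫ x, A x * H1 x) + (2 * β - 1 + 2 * ∫ x in Set.Ioi β, H1 x) := by
    have hPP : Integrable (fun x => (P x + P (-x)) / 2) := (hPi.add hPn).div_const 2
    rw [hM, integral_add hPP hχi, hχint, integral_div,
      integral_add hPi hPn, integral_neg_eq_self P volume, hPint]
    ring
  rw [hM2]
  have ht := tail_H1 β hβ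
  set J := ∫ x in Set.Ioi β, H1 x
  set K := ∫ x, A x * H1 x
  have e : 1 / 2 * (ε / Δ - K + (2 * β - 1 + 2 * J)) - (β - 1 / 2 + ε / (2 * Δ) + 1 / (2 * π ^ 2 * β))
      = (J - 1 / (2 * π ^ 2 * β)) - K / 2 := by
    have : ε / (2 * Δ) = ε / Δ / 2 := by field_simp
    rw [this]; ring
  rw [e]
  have h8 := abs_sub (J - 1 / (2 * π ^ 2 * β)) (K / 2)
  have h9 : |K / 2| = |K| / 2 := by rw [abs_div]; simp
  have h10 : 0 < 1 / β ^ 2 := by positivity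
  have h11 : 16 / β ^ 2 = 16 * (1 / β ^ 2) := by ring
  have h12 : 20 / β ^ 2 = 20 * (1 / β ^ 2) := by ring
  linarith

theorem M_of_dilated_beurling_selberg_asymptotic (Δ : ℝ) (hΔ : 1 ≤ Δ) :
    ∃ C > 0, ∃ β₀ > 0, ∀ β ≥ β₀,
      |(1 / 2) * Mpc (sPlus Δ β) - (β - 1 / 2 + 1 / (2 * Δ) + 1 / (2 * π ^ 2 * β))| ≤
        C / β ^ 2 ∧
      |(1 / 2) * Mpc (sMinus Δ β) - (β - 1 / 2 - 1 / (2 * Δ) + 1 / (2 * π ^ 2 * β))| ≤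
        C / β ^ 2 := by
  have hb := H0_sub_sign
  refine ⟨20, by norm_num, 1, one_pos, fun β hβ => ⟨?_, ?_⟩⟩
  · refine main_generic Δ hΔ Hplus 1 ?_ ?_ ?_ β hβ
    · exact (e_integrable.add H1_integrable).congr (Eventually.of_forall fun x => by
        simp only [Hplus, Pi.add_apply]; ring)
    · filter_upwards [hb] with x hx
      have h1 := H1_nonneg x
      rw [abs_le] at hx ⊢
      unfold Hplus
      constructor <;> linarith [hx.1, hx.2]
    · have : ∀ x, Hplus x - Real.sign x = (H0 x - Real.sign x) + H1 x := fun x => by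
        unfold Hplus; ring
      simp_rw [this]
      rw [integral_add e_integrable H1_integrable, integral_e, integral_H1, zero_add]
  · have h := main_generic Δ hΔ Hminus (-1) ?_ ?_ ?_ β hβ
    · rw [neg_div, ← sub_eq_add_neg] at h
      exact h
    · exact (e_integrable.sub H1_integrable).congr (Eventually.of_forall fun x => by
        simp only [Hminus, Pi.sub_apply]; ring)
    · filter_upwards [hb] with x hx
      have h1 := H1_nonneg x
      rw [abs_le] at hx ⊢
      unfold Hminus
      constructor <;> linarith [hx.1, hx.2]
    · have : ∀ x, Hminus x - Real.sign x = (H0 x - Real.sign x) - H1 x := fun x => by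
        unfold Hminus; ring
      simp_rw [this]
      rw [integral_sub e_integrable H1_integrable, integral_e, integral_H1, zero_sub]
end
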